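/- Suppose that either (1) (Poly-R₁) and HK^h_B hold, or (2) (Poly-∞) and HK^h_U hold. Then there exists a constant C≥1 such that for all x,y∈D with x≠y, C^{−1}[ C₀𝔅*_h(x,y)/(V(x,ρ(x,y))Ψ(ρ(x,y))) + h(Φ(ρ(x,y)),x,y)·w(Φ(ρ(x,y)))/V(x,ρ(x,y)) ] ≤ J(x,y) ≤ C[ C₀𝔅*_h(x,y)/(V(x,ρ(x,y))Ψ(ρ(x,y))) + h(Φ(ρ(x,y)),x,y)·w(Φ(ρ(x,y)))/V(x,ρ(x,y)) ], where 𝔅*_h(x,y):=∫_0^{Φ(ρ(x,y))} h(s,x,y)w(s)ds. -/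

import Mathlib

open MeasureTheory Real Set
open scoped ENNReal

/-- Tail of the Lévy measure: `w(r) = ν((r,∞))`. -/
noncomputable def levyTail (ν : Measure ℝ) (r : ℝ) : ℝ := (ν (Set.Ioi r)).toReal

/-- Laplace exponent `φ(λ) = ∫ (1 - e^{-λ s}) ν(ds)`. -/
noncomputable def laplaceExp (ν : Measure ℝ) (lam : ℝ) : ℝ :=
  ∫ s, (1 - Real.exp (-(lam * s))) ∂ν

/-- Condition (Poly-R₁); (Poly-∞) is the case `R₁ = ⊤`. -/
def PolyCond (ν : Measure ℝ) (R₁ : ℝ≥0∞) (c c' β₁ β₂ : ℝ) : Prop :=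
  ∀ r R : ℝ, 0 < r → r ≤ R → ENNReal.ofReal R < R₁ →
    c * (R / r) ^ β₁ ≤ levyTail ν r / levyTail ν R ∧
      levyTail ν r / levyTail ν R ≤ c' * (R / r) ^ β₂

/-- `ν` is the Lévy measure of a driftless subordinator. -/
structure IsLevyMeasure (ν : Measure ℝ) : Prop where
  supp : ν (Set.Iic 0) = 0
  tail_fin : ∀ r : ℝ, 0 < r → ν (Set.Ioi r) < ⊤
  integ : IntegrableOn (fun s => s) (Set.Ioc (0:ℝ) 1) ν

/-- `μ t` is the law of `S_t` for the driftless subordinator with Lévy measure `ν`. -/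
structure IsSubordinatorLaw (ν : Measure ℝ) (μ : ℝ → Measure ℝ) : Prop where
  levy : IsLevyMeasure ν
  prob : ∀ t : ℝ, 0 < t → IsProbabilityMeasure (μ t)
  nonneg : ∀ t : ℝ, 0 < t → μ t (Set.Iio 0) = 0
  laplace : ∀ t lam : ℝ, 0 < t → 0 ≤ lam →
    (∫ s, Real.exp (-(lam * s)) ∂(μ t)) = Real.exp (-(t * laplaceExp ν lam))

/-- `H(λ) = φ(λ) - λ φ'(λ)`. -/
noncomputable def Hfun (ν : Measure ℝ) (lam : ℝ) : ℝ :=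
  laplaceExp ν lam - lam * deriv (laplaceExp ν) lam

/-- `σ(t,s) = (φ')⁻¹(s/t)` if `s/t < φ'(0+)`, and `σ(t,s) = 0` otherwise. -/
def IsSigmaFun (ν : Measure ℝ) (σ : ℝ → ℝ → ℝ) : Prop :=
  ∀ t s : ℝ, 0 < t → 0 < s →
    ((∃ lam : ℝ, 0 < lam ∧ s / t < deriv (laplaceExp ν) lam) →
      0 < σ t s ∧ deriv (laplaceExp ν) (σ t s) = s / t) ∧
    ((∀ lam : ℝ, 0 < lam → deriv (laplaceExp ν) lam ≤ s / t) → σ t s = 0)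

/-- `φInv` is the inverse of the Laplace exponent `φ` on `(0,∞)`. -/
def IsPhiInv (ν : Measure ℝ) (φInv : ℝ → ℝ) : Prop :=
  ∀ u : ℝ, 0 < u → 0 < φInv u ∧ laplaceExp ν (φInv u) = u

/-- `HInv` is the inverse of `H` on `(0,∞)`. -/
def IsHInv (ν : Measure ℝ) (HInv : ℝ → ℝ) : Prop :=
  ∀ u : ℝ, 0 < u → 0 < HInv u ∧ Hfun ν (HInv u) = u

open Metric

/-- `V(x,r) = m(B(x,r))`. -/
noncomputable def vol {E : Type*} [PseudoMetricSpace E] [MeasurableSpace E] (m : Measure E) (x : E) (r : ℝ) : ℝ :=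
  (m (Metric.ball x r)).toReal

/-- Volume doubling and reverse doubling with exponents `d₁ ≤ d₂` and
localization radius `R_E`. -/
def VolDoubling {E : Type*} [PseudoMetricSpace E] [MeasurableSpace E] (m : Measure E) (R_E : ℝ≥0∞)
    (d₁ d₂ : ℝ) : Prop :=
  ∀ a : ℝ, 1 ≤ a → ∃ CV : ℝ, 1 ≤ CV ∧ ∀ (x : E) (r R : ℝ), 0 < r → r ≤ R →
    ENNReal.ofReal R < ENNReal.ofReal a * R_E →
    CV⁻¹ * (R / r) ^ d₁ ≤ vol m x R / vol m x r ∧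
      vol m x R / vol m x r ≤ CV * (R / r) ^ d₂

/-- Global weak scaling condition with indices `α₁ ≤ α₂`. -/
def WeakScaling (Φ : ℝ → ℝ) (c c' α₁ α₂ : ℝ) : Prop :=
  ∀ r R : ℝ, 0 < r → r ≤ R →
    c * (R / r) ^ α₁ ≤ Φ R / Φ r ∧ Φ R / Φ r ≤ c' * (R / r) ^ α₂

/-- `h` is a boundary function on `D`: it takes values in `[0,1]`, satisfies (H1)
(non-increasing in time) and (H2) with constant `cH` and exponent `γ` below the
time horizon `T` (`T = ⊤` for unbounded `D`). -/
def IsBoundaryFunction {E : Type*} (D : Set E) (h : ℝ → E → E → ℝ) (T : ℝ≥0∞)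
    (cH γ : ℝ) : Prop :=
  (∀ (t : ℝ) (x y : E), 0 < t → x ∈ D → y ∈ D → h t x y ∈ Set.Icc (0:ℝ) 1) ∧
  (∀ (x y : E), x ∈ D → y ∈ D → ∀ s t : ℝ, 0 < s → s ≤ t → h t x y ≤ h s x y) ∧
  (∀ (x y : E), x ∈ D → y ∈ D → ∀ s t : ℝ, 0 < s → s ≤ t → ENNReal.ofReal t < T →
    s ^ γ * h s x y ≤ cH * (t ^ γ * h t x y))

/-- Two-sided estimate (3.4) for the heat kernel `p_D` of `Y^D`, holding for all times
`t` with `0 < t` satisfying `tcond t`. -/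
def HKest {E : Type*} [PseudoMetricSpace E] [MeasurableSpace E] (m : Measure E) (D : Set E)
    (Ψ ΦInv : ℝ → ℝ) (h pD : ℝ → E → E → ℝ)
    (C₀ cl cexl cu cexu : ℝ) (tcond : ℝ → Prop) : Prop :=
  ∀ (t : ℝ) (x y : E), 0 < t → tcond t → x ∈ D → y ∈ D →
    cl * h t x y * min ((vol m x (ΦInv t))⁻¹)
        (C₀ * t / (vol m x (dist x y) * Ψ (dist x y)) +
          (vol m x (ΦInv t))⁻¹ * Real.exp (-(cexl * dist x y ^ 2 / ΦInv t ^ 2)))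
      ≤ pD t x y ∧
    pD t x y ≤ cu * h t x y * min ((vol m x (ΦInv t))⁻¹)
        (C₀ * t / (vol m x (dist x y) * Ψ (dist x y)) +
          (vol m x (ΦInv t))⁻¹ * Real.exp (-(cexu * dist x y ^ 2 / ΦInv t ^ 2)))

/-- Large-time estimate (3.5): `p_D(t,x,y) ≍ e^{-λ_D t} h(1,x,y)` for `t ≥ 1`. -/
def HKlarge {E : Type*} (D : Set E) (h pD : ℝ → E → E → ℝ) (lamD c₅ c₆ : ℝ) : Prop :=
  ∀ (t : ℝ) (x y : E), 1 ≤ t → x ∈ D → y ∈ D →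
    c₅ * Real.exp (-(lamD * t)) * h 1 x y ≤ pD t x y ∧
      pD t x y ≤ c₆ * Real.exp (-(lamD * t)) * h 1 x y

/-- Heat kernel `q(t,x,y) = ∫ p_D(s,x,y) P(S_t ∈ ds)` of the subordinate process. -/
noncomputable def subq {E : Type*} (μ : ℝ → Measure ℝ) (pD : ℝ → E → E → ℝ)
    (t : ℝ) (x y : E) : ℝ :=
  ∫ s, pD s x y ∂(μ t)

/-- Jump kernel `J(x,y) = ∫ p_D(s,x,y) ν(ds)` of the subordinate process. -/
noncomputable def subJ {E : Type*} (ν : Measure ℝ) (pD : ℝ → E → E → ℝ) (x y : E) : ℝ :=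
  ∫ s, pD s x y ∂ν

/-- Green function `G_D(x,y) = ∫_0^∞ q(t,x,y) dt` of the subordinate process. -/
noncomputable def subG {E : Type*} (μ : ℝ → Measure ℝ) (pD : ℝ → E → E → ℝ)
    (x y : E) : ℝ :=
  ∫ t in Set.Ioi (0:ℝ), subq μ pD t x y

/-- `ψ(r) = 1/φ(1/Φ(r))`. -/
noncomputable def psiFun (ν : Measure ℝ) (Φ : ℝ → ℝ) (r : ℝ) : ℝ :=
  (laplaceExp ν ((Φ r)⁻¹))⁻¹

/-- `𝔅_h(t,x,y) = ∫_{2/φ⁻¹(1/t)}^{4Φ(ρ(x,y))} h(s,x,y) w(s) ds`. -/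
noncomputable def sB {E : Type*} [PseudoMetricSpace E] [MeasurableSpace E] (ν : Measure ℝ)
    (h : ℝ → E → E → ℝ) (Φ φInv : ℝ → ℝ) (t : ℝ) (x y : E) : ℝ :=
  ∫ s in Set.Ioc (2 * (φInv (t⁻¹))⁻¹) (4 * Φ (dist x y)), h s x y * levyTail ν s

/-- Hypotheses of case (1): (Poly-R₁) holds and `HK^h_B` holds. -/
def BddCaseHyp {E : Type*} [PseudoMetricSpace E] [MeasurableSpace E] (m : Measure E) (D : Set E)
    (Φ Ψ ΦInv : ℝ → ℝ) (h pD : ℝ → E → E → ℝ) (ν : Measure ℝ)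
    (R₁ : ℝ≥0∞) (cw cw' β₁ β₂ cH γ C₀ cl cexl cu cexu : ℝ) : Prop :=
  PolyCond ν R₁ cw cw' β₁ β₂ ∧
  Bornology.IsBounded D ∧
  ENNReal.ofReal (8 * Φ (Metric.diam D)) < R₁ ∧
  IsBoundaryFunction D h (ENNReal.ofReal (4 * Φ (Metric.diam D) + 1)) cH γ ∧
  HKest m D Ψ ΦInv h pD C₀ cl cexl cu cexu (fun t => t ≤ 1) ∧
  ∃ lamD c₅ c₆ : ℝ, 0 < lamD ∧ 0 < c₅ ∧ 0 < c₆ ∧ HKlarge D h pD lamD c₅ c₆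

/-- Hypotheses of case (2): (Poly-∞) holds and `HK^h_U` holds (with `R_E = ⊤`). -/
def UnbddCaseHyp {E : Type*} [PseudoMetricSpace E] [MeasurableSpace E] (m : Measure E) (D : Set E)
    (Ψ ΦInv : ℝ → ℝ) (h pD : ℝ → E → E → ℝ) (ν : Measure ℝ)
    (R_E : ℝ≥0∞) (cw cw' β₁ β₂ cH γ C₀ cl cexl cu cexu : ℝ) : Prop :=
  PolyCond ν ⊤ cw cw' β₁ β₂ ∧
  R_E = ⊤ ∧
  IsBoundaryFunction D h ⊤ cH γ ∧
  HKest m D Ψ ΦInv h pD C₀ cl cexl cu cexu (fun _ => True)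

/-- On-diagonal expression `h(1/φ⁻¹(1/t),x,y) / V(x, ψ⁻¹(t))`. -/
noncomputable def onDiag {E : Type*} [PseudoMetricSpace E] [MeasurableSpace E] (m : Measure E)
    (h : ℝ → E → E → ℝ) (ΦInv φInv : ℝ → ℝ) (t : ℝ) (x y : E) : ℝ :=
  h ((φInv (t⁻¹))⁻¹) x y / vol m x (ΦInv ((φInv (t⁻¹))⁻¹))

/-- Off-diagonal expression in Theorem 4.2(ii), with constant `c` in the exponential. -/
noncomputable def offDiag {E : Type*} [PseudoMetricSpace E] [MeasurableSpace E] (ν : Measure ℝ)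
    (m : Measure E) (h : ℝ → E → E → ℝ) (Φ Ψ ΦInv φInv : ℝ → ℝ)
    (C₀ c t : ℝ) (x y : E) : ℝ :=
  C₀ / (vol m x (dist x y) * Ψ (dist x y)) *
      (t * sB ν h Φ φInv t x y + h ((φInv (t⁻¹))⁻¹) x y / φInv (t⁻¹)) +
    h ((φInv (t⁻¹))⁻¹) x y / vol m x (ΦInv ((φInv (t⁻¹))⁻¹)) *
      Real.exp (-(c * dist x y ^ 2 / ΦInv ((φInv (t⁻¹))⁻¹) ^ 2)) +
    h (Φ (dist x y)) x y * (t * levyTail ν (Φ (dist x y))) / vol m x (dist x y)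

theorem jk_sigmaFinite {ν : Measure ℝ} (hν : IsLevyMeasure ν) : SigmaFinite ν := by
  refine ⟨⟨⟨fun n : ℕ => Set.Iic 0 ∪ Set.Ioi (1 / ((n:ℝ) + 1)), fun _ => trivial, ?_, ?_⟩⟩⟩
  · intro n
    refine (measure_union_le _ _).trans_lt ?_
    rw [hν.supp, zero_add]
    exact hν.tail_fin _ (by positivity)
  · refine Set.eq_univ_of_forall fun x => ?_
    rw [Set.mem_iUnion]
    rcases le_or_gt x 0 with hx | hx
    · exact ⟨0, Or.inl hx⟩
    · obtain ⟨n, hn⟩ := exists_nat_one_div_lt hx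
      exact ⟨n, Or.inr hn⟩

theorem jk_ofReal_tail {ν : Measure ℝ} (hν : IsLevyMeasure ν) {u : ℝ} (hu : 0 < u) :
    ENNReal.ofReal (levyTail ν u) = ν (Set.Ioi u) :=
  ENNReal.ofReal_toReal (hν.tail_fin u hu).ne

theorem jk_tail_nonneg (ν : Measure ℝ) (u : ℝ) : 0 ≤ levyTail ν u := ENNReal.toReal_nonneg

theorem jk_tail_anti {ν : Measure ℝ} (hν : IsLevyMeasure ν) {u v : ℝ} (hu : 0 < u) (huv : u ≤ v) :
    levyTail ν v ≤ levyTail ν u :=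
  ENNReal.toReal_mono (hν.tail_fin u hu).ne (measure_mono (Set.Ioi_subset_Ioi huv))

theorem jk_tail_split {ν : Measure ℝ} {u v : ℝ} (huv : u ≤ v) :
    ν (Set.Ioi u) = ν (Set.Ioc u v) + ν (Set.Ioi v) := by
  rw [← Set.Ioc_union_Ioi_eq_Ioi huv, measure_union _ measurableSet_Ioi]
  exact Set.Ioc_disjoint_Ioi le_rfl

theorem jk_half {ν : Measure ℝ} (hν : IsLevyMeasure ν) {u v : ℝ} (hu : 0 < u) (huv : u ≤ v)
    (hw : levyTail ν v ≤ levyTail ν u / 2) :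
    ENNReal.ofReal (levyTail ν u / 2) ≤ ν (Set.Ioc u v) := by
  have hfin : ν (Set.Ioc u v) ≠ ⊤ :=
    ((measure_mono Set.Ioc_subset_Ioi_self).trans_lt (hν.tail_fin u hu)).ne
  refine ENNReal.ofReal_le_of_le_toReal ?_
  have := congrArg ENNReal.toReal (jk_tail_split (ν := ν) huv)
  rw [ENNReal.toReal_add hfin (hν.tail_fin v (hu.trans_le huv)).ne] at this
  unfold levyTail at *
  linarith

theorem jk_layer (ν : Measure ℝ) (T : ℝ) (g : ℝ → ℝ)
    (gi : ∀ t > 0, IntervalIntegrable g volume 0 t) (gn : ∀ t, 0 < t → 0 ≤ g t) :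
    ∫⁻ s in Set.Ioc 0 T, ENNReal.ofReal (∫ t in (0:ℝ)..s, g t) ∂ν
      = ∫⁻ u in Set.Ioc 0 T, ν (Set.Ioc u T) * ENNReal.ofReal (g u) := by
  have := lintegral_comp_eq_lintegral_meas_lt_mul (ν.restrict (Set.Ioc 0 T)) (f := fun s => s) (g := g)
    ((ae_restrict_mem measurableSet_Ioc).mono fun s hs => hs.1.le) aemeasurable_id gi
    ((ae_restrict_mem measurableSet_Ioi).mono fun s hs => gn s hs)
  rw [this]
  have h1 : ∀ u ∈ Set.Ioi (0:ℝ), (ν.restrict (Set.Ioc 0 T)) {a : ℝ | u < a} * ENNReal.ofReal (g u)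
      = (Set.Ioc 0 T).indicator (fun u => ν (Set.Ioc u T) * ENNReal.ofReal (g u)) u := by
    intro u hu
    have hset : {a : ℝ | u < a} ∩ Set.Ioc 0 T = Set.Ioc u T := by
      ext a; simp only [Set.mem_inter_iff, Set.mem_ofPred_eq, Set.mem_Ioc]
      exact ⟨fun h => ⟨h.1, h.2.2⟩, fun h => ⟨h.1, (Set.mem_Ioi.1 hu).trans h.1, h.2⟩⟩
    rw [show {a : ℝ | u < a} = Set.Ioi u from rfl] at hset ⊢
    rw [Measure.restrict_apply (measurableSet_Ioi : MeasurableSet (Set.Ioi u)), hset]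
    by_cases hT : u ≤ T
    · have hmem : u ∈ Set.Ioc 0 T := ⟨hu, hT⟩
      rw [Set.indicator_of_mem hmem]
    · rw [Set.indicator_of_notMem (fun h => hT h.2), Set.Ioc_eq_empty (by linarith)]; simp
  rw [setLIntegral_congr_fun measurableSet_Ioi h1, lintegral_indicator measurableSet_Ioc,
    Measure.restrict_restrict measurableSet_Ioc, Set.inter_eq_left.2 Set.Ioc_subset_Ioi_self]

theorem jk_layer_le {ν : Measure ℝ} (hν : IsLevyMeasure ν) (T : ℝ) (g : ℝ → ℝ)
    (gi : ∀ t > 0, IntervalIntegrable g volume 0 t) (gn : ∀ t, 0 < t → 0 ≤ g t) :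
    ∫⁻ s in Set.Ioc 0 T, ENNReal.ofReal (∫ t in (0:ℝ)..s, g t) ∂ν
      ≤ ∫⁻ u in Set.Ioc 0 T, ENNReal.ofReal (g u * levyTail ν u) := by
  rw [jk_layer ν T g gi gn]
  refine setLIntegral_mono' measurableSet_Ioc fun u hu => ?_
  rw [ENNReal.ofReal_mul (gn u hu.1), jk_ofReal_tail hν hu.1, mul_comm]
  gcongr
  exact Set.Ioc_subset_Ioi_self

theorem jk_fin_tail {ν : Measure ℝ} (hν : IsLevyMeasure ν) (T : ℝ) (hT : 0 < T) :
    ∫⁻ u in Set.Ioc 0 T, ENNReal.ofReal (levyTail ν u) < ⊤ := by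
  have h1 : ∫⁻ s in Set.Ioc 0 T, ENNReal.ofReal s ∂ν < ⊤ := by
    have hsub : Set.Ioc 0 T ⊆ Set.Ioc 0 1 ∪ Set.Ioc 1 T := fun s hs => by
      rcases le_or_gt s 1 with h | h
      · exact Or.inl ⟨hs.1, h⟩
      · exact Or.inr ⟨h, hs.2⟩
    refine (lintegral_mono_set hsub).trans_lt ((lintegral_union_le _ _ _).trans_lt ?_)
    refine ENNReal.add_lt_top.2 ⟨?_, ?_⟩
    · exact hν.integ.lintegral_lt_top
    · calc ∫⁻ s in Set.Ioc 1 T, ENNReal.ofReal s ∂ν ≤ ∫⁻ s in Set.Ioc 1 T, ENNReal.ofReal T ∂ν :=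
            setLIntegral_mono' measurableSet_Ioc fun s hs => ENNReal.ofReal_le_ofReal hs.2
        _ = ENNReal.ofReal T * ν (Set.Ioc 1 T) := setLIntegral_const _ _
        _ < ⊤ := ENNReal.mul_lt_top ENNReal.ofReal_lt_top
            ((measure_mono Set.Ioc_subset_Ioi_self).trans_lt (hν.tail_fin 1 one_pos))
  have h2 := jk_layer ν T (fun _ => 1) (fun t _ => intervalIntegrable_const) (fun _ _ => zero_le_one)
  simp only [intervalIntegral.integral_const, sub_zero, smul_eq_mul, mul_one, ENNReal.ofReal_one] at h2
  rw [h2] at h1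
  calc ∫⁻ u in Set.Ioc 0 T, ENNReal.ofReal (levyTail ν u)
      = ∫⁻ u in Set.Ioc 0 T, (ν (Set.Ioc u T) + ν (Set.Ioi T)) :=
        setLIntegral_congr_fun measurableSet_Ioc fun u hu => by
          simp only [jk_ofReal_tail hν hu.1, jk_tail_split hu.2]
    _ = (∫⁻ u in Set.Ioc 0 T, ν (Set.Ioc u T)) + ν (Set.Ioi T) * volume (Set.Ioc 0 T) := by
        rw [lintegral_add_right _ measurable_const, setLIntegral_const]
    _ < ⊤ := ENNReal.add_lt_top.2 ⟨h1, ENNReal.mul_lt_top (hν.tail_fin T hT) (by simp)⟩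

theorem jk_upper1 {ν : Measure ℝ} (hν : IsLevyMeasure ν) (T : ℝ) (h : ℝ → ℝ) (ha : Antitone h)
    (h0 : ∀ s, 0 ≤ h s) :
    ∫⁻ s in Set.Ioc 0 T, ENNReal.ofReal (h s * s) ∂ν
      ≤ ∫⁻ u in Set.Ioc 0 T, ENNReal.ofReal (h u * levyTail ν u) := by
  refine le_trans ?_ (jk_layer_le hν T h (fun t _ => ha.intervalIntegrable) fun t _ => h0 t)
  refine setLIntegral_mono' measurableSet_Ioc fun s hs => ENNReal.ofReal_le_ofReal ?_
  have : ∫ t in (0:ℝ)..s, h s ≤ ∫ t in (0:ℝ)..s, h t :=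
    intervalIntegral.integral_mono_on hs.1.le intervalIntegrable_const ha.intervalIntegrable
      fun t ht => ha ht.2
  rw [intervalIntegral.integral_const] at this
  simpa [mul_comm] using this

theorem jk_upper2 {ν : Measure ℝ} (hν : IsLevyMeasure ν) (T : ℝ) (hT : 0 < T) (c β : ℝ)
    (hβ : 0 < β)
    (hw : ∀ u, 0 < u → u ≤ T → levyTail ν u ≤ c * (T / u) ^ β * levyTail ν T) :
    ∫⁻ s in Set.Ioc 0 T, ENNReal.ofReal ((s / T) ^ (β + 1)) ∂ν
      ≤ ENNReal.ofReal (c * (β + 1) * levyTail ν T) := by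
  have hk : 0 < β + 1 := by linarith
  have gi : ∀ t > 0, IntervalIntegrable (fun u : ℝ => (β + 1) * T ^ (-(β + 1)) * u ^ β) volume 0 t :=
    fun t _ => (intervalIntegral.intervalIntegrable_rpow' (by linarith)).const_mul _
  have gn : ∀ t : ℝ, 0 < t → 0 ≤ (β + 1) * T ^ (-(β + 1)) * t ^ β := fun t ht => by positivity
  have e1 : ∀ s ∈ Set.Ioc 0 T, ENNReal.ofReal ((s / T) ^ (β + 1)) = ENNReal.ofReal
      (∫ t in (0:ℝ)..s, (β + 1) * T ^ (-(β + 1)) * t ^ β) := fun s hs => by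
    rw [intervalIntegral.integral_const_mul, integral_rpow (Or.inl (by linarith)),
      Real.zero_rpow hk.ne', Real.div_rpow hs.1.le hT.le, Real.rpow_neg hT.le]
    congr 1; field_simp; ring
  rw [setLIntegral_congr_fun measurableSet_Ioc e1]
  refine (jk_layer_le hν T _ gi gn).trans ?_
  calc ∫⁻ u in Set.Ioc 0 T, ENNReal.ofReal ((β + 1) * T ^ (-(β + 1)) * u ^ β * levyTail ν u)
      ≤ ∫⁻ u in Set.Ioc 0 T, ENNReal.ofReal (c * (β + 1) * levyTail ν T / T) := by
        refine setLIntegral_mono' measurableSet_Ioc fun u hu => ENNReal.ofReal_le_ofReal ?_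
        have hu0 := hu.1
        calc (β + 1) * T ^ (-(β + 1)) * u ^ β * levyTail ν u
            ≤ (β + 1) * T ^ (-(β + 1)) * u ^ β * (c * (T / u) ^ β * levyTail ν T) := by
              gcongr; exact hw u hu.1 hu.2
          _ = c * (β + 1) * levyTail ν T / T := by
              rw [Real.div_rpow hT.le hu0.le, Real.rpow_neg hT.le, Real.rpow_add hT, Real.rpow_one]
              have := (Real.rpow_pos_of_pos hT β).ne'
              have := (Real.rpow_pos_of_pos hu0 β).ne'
              field_simp
    _ = ENNReal.ofReal (c * (β + 1) * levyTail ν T / T) * ENNReal.ofReal T := by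
        rw [setLIntegral_const, Real.volume_Ioc, sub_zero]
    _ = ENNReal.ofReal (c * (β + 1) * levyTail ν T) := by
        rw [← ENNReal.ofReal_mul' hT.le]; congr 1; field_simp

theorem jk_lower {ν : Measure ℝ} (hν : IsLevyMeasure ν) (T : ℝ) (hT : 0 < T) (c β K C3 γ : ℝ)
    (hβ : 0 < β) (hK : 1 ≤ K) (hC3 : 0 < C3) (hγ : 0 ≤ γ) (hc : 0 < c)
    (hw : ∀ u, 0 < u → u ≤ T → levyTail ν u ≤ c * (T / u) ^ β * levyTail ν T)
    (hg : ∀ u, 0 < u → u ≤ T → levyTail ν (K * u) ≤ levyTail ν u / 2)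
    (h : ℝ → ℝ) (ha : Antitone h) (h0 : ∀ s, 0 ≤ h s)
    (hh : ∀ s t, 0 < s → s ≤ t → t ≤ T → h s ≤ C3 * (t / s) ^ γ * h t) :
    ∫⁻ u in Set.Ioc 0 T, ENNReal.ofReal (h u * levyTail ν u) ≤
      ENNReal.ofReal (2 * C3 * K ^ γ) * ∫⁻ s in Set.Ioc 0 T, ENNReal.ofReal (h s * s) ∂ν +
      ENNReal.ofReal (C3 * K ^ γ * (c * K ^ β) * (T * h T * levyTail ν T)) := by
  have hsf := jk_sigmaFinite hν
  have hK0 : 0 < K := by linarith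
  have hTK : T / K ≤ T := div_le_self hT.le hK
  have hTK0 : 0 < T / K := by positivity
  rw [← Set.Ioc_union_Ioc_eq_Ioc hTK0.le hTK]
  refine (lintegral_union_le _ _ _).trans (add_le_add ?_ ?_)
  · rw [Set.Ioc_union_Ioc_eq_Ioc hTK0.le hTK]
    set F : ℝ → ℝ → ℝ≥0∞ := fun u s =>
      if 0 < u ∧ u < s then ENNReal.ofReal (2 * C3 * K ^ γ * h s) else 0 with hF
    have hFm : Measurable (Function.uncurry F) := by
      refine Measurable.ite ?_ ?_ measurable_const
      · exact (measurableSet_lt measurable_const measurable_fst).inter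
          (measurableSet_lt measurable_fst measurable_snd)
      · exact ((ha.measurable.comp measurable_snd).const_mul _).ennreal_ofReal
    calc ∫⁻ u in Set.Ioc 0 (T / K), ENNReal.ofReal (h u * levyTail ν u)
        ≤ ∫⁻ u in Set.Ioc 0 (T / K), ∫⁻ s in Set.Ioc 0 T, F u s ∂ν := by
          refine setLIntegral_mono' measurableSet_Ioc fun u hu => ?_
          have hu0 := hu.1
          have huT := hu.2.trans hTK
          have hKu : u ≤ K * u := le_mul_of_one_le_left hu0.le hK
          have hKuT : K * u ≤ T := by
            have := hu.2; rw [le_div_iff₀ hK0] at this; linarith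
          calc ENNReal.ofReal (h u * levyTail ν u)
              = ENNReal.ofReal (2 * h u) * ENNReal.ofReal (levyTail ν u / 2) := by
                rw [← ENNReal.ofReal_mul (by have := h0 u; positivity)]; congr 1; ring
            _ ≤ ENNReal.ofReal (2 * h u) * ν (Set.Ioc u (K * u)) := by
                gcongr; exact jk_half hν hu0 hKu (hg u hu0 huT)
            _ = ∫⁻ s in Set.Ioc u (K * u), ENNReal.ofReal (2 * h u) ∂ν := by
                rw [setLIntegral_const]
            _ ≤ ∫⁻ s in Set.Ioc u (K * u), F u s ∂ν := by
                refine setLIntegral_mono' measurableSet_Ioc fun s hs => ?_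
                rw [hF]; simp only [hu0, hs.1, and_self, if_true]
                refine ENNReal.ofReal_le_ofReal ?_
                have h1 := hh u s hu0 hs.1.le (hs.2.trans hKuT)
                have h2 : (s / u) ^ γ ≤ K ^ γ :=
                  Real.rpow_le_rpow (by have := hu0.trans hs.1; positivity)
                    ((div_le_iff₀ hu0).2 hs.2) hγ
                have h3 : C3 * (s / u) ^ γ * h s ≤ C3 * K ^ γ * h s := by
                  have := h0 s; gcongr
                linarith
            _ ≤ ∫⁻ s in Set.Ioc 0 T, F u s ∂ν :=
                lintegral_mono_set (Set.Ioc_subset_Ioc hu0.le hKuT)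
      _ = ∫⁻ s in Set.Ioc 0 T, (∫⁻ u in Set.Ioc 0 (T / K), F u s) ∂ν :=
          lintegral_lintegral_swap hFm.aemeasurable
      _ ≤ ∫⁻ s in Set.Ioc 0 T, ENNReal.ofReal (2 * C3 * K ^ γ) * ENNReal.ofReal (h s * s) ∂ν := by
          refine setLIntegral_mono' measurableSet_Ioc fun s hs => ?_
          calc ∫⁻ u in Set.Ioc 0 (T / K), F u s
              ≤ ∫⁻ u, F u s := setLIntegral_le_lintegral _ _
            _ = ∫⁻ u, (Set.Ioo 0 s).indicator (fun _ => ENNReal.ofReal (2 * C3 * K ^ γ * h s)) u := by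
                refine lintegral_congr fun u => ?_
                simp only [hF, Set.indicator, Set.mem_Ioo]
            _ = ENNReal.ofReal (2 * C3 * K ^ γ * h s) * ENNReal.ofReal s := by
                rw [lintegral_indicator measurableSet_Ioo, setLIntegral_const, Real.volume_Ioo,
                  sub_zero]
            _ = ENNReal.ofReal (2 * C3 * K ^ γ) * ENNReal.ofReal (h s * s) := by
                rw [← ENNReal.ofReal_mul' hs.1.le, ← ENNReal.ofReal_mul (by positivity)]
                congr 1; ring
            _ ≤ _ := le_rfl
      _ = _ := lintegral_const_mul _ (by
          exact (ha.measurable.mul measurable_id).ennreal_ofReal)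
  · calc ∫⁻ u in Set.Ioc (T / K) T, ENNReal.ofReal (h u * levyTail ν u)
        ≤ ∫⁻ u in Set.Ioc (T / K) T,
            ENNReal.ofReal (C3 * K ^ γ * (c * K ^ β) * (h T * levyTail ν T)) := by
          refine setLIntegral_mono' measurableSet_Ioc fun u hu => ENNReal.ofReal_le_ofReal ?_
          have hu0 : 0 < u := hTK0.trans hu.1
          have hr : T / u ≤ K := by
            have := hu.1; rw [div_lt_iff₀ hK0] at this; rw [div_le_iff₀ hu0]; linarith
          have h1 : h u ≤ C3 * K ^ γ * h T := (hh u T hu0 hu.2 le_rfl).trans (by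
            have := h0 T; gcongr)
          have h2 : levyTail ν u ≤ c * K ^ β * levyTail ν T := (hw u hu0 hu.2).trans (by
            have := jk_tail_nonneg ν T; gcongr)
          calc h u * levyTail ν u ≤ (C3 * K ^ γ * h T) * (c * K ^ β * levyTail ν T) :=
                mul_le_mul h1 h2 (jk_tail_nonneg ν u) (by have := h0 T; positivity)
            _ = _ := by ring
      _ = ENNReal.ofReal (C3 * K ^ γ * (c * K ^ β) * (h T * levyTail ν T)) *
            ENNReal.ofReal (T - T / K) := by rw [setLIntegral_const, Real.volume_Ioc]
      _ ≤ ENNReal.ofReal (C3 * K ^ γ * (c * K ^ β) * (h T * levyTail ν T)) *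
            ENNReal.ofReal T := by gcongr; linarith
      _ = _ := by
          rw [← ENNReal.ofReal_mul' hT.le]; congr 1; ring

theorem jk_core {ν : Measure ℝ} (hν : IsLevyMeasure ν) (c β K C3 γ C1 C2 : ℝ)
    (hβ : 0 < β) (hK : 1 ≤ K) (hC3 : 0 < C3) (hγ : 0 ≤ γ) (hc : 0 < c) (hC1 : 0 < C1)
    (hC2 : 0 < C2) :
    ∃ C : ℝ, 1 ≤ C ∧ ∀ (T A B : ℝ) (h p : ℝ → ℝ), 0 < T → 0 ≤ A → 0 ≤ B → A * T ≤ B →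
    (∀ u, 0 < u → u ≤ T → levyTail ν u ≤ c * (T / u) ^ β * levyTail ν T) →
    (∀ u, 0 < u → u ≤ T → levyTail ν (K * u) ≤ levyTail ν u / 2) →
    Antitone h → (∀ s, 0 ≤ h s) → (∀ s, h s ≤ 1) →
    (∀ s t, 0 < s → s ≤ t → t ≤ T → h s ≤ C3 * (t / s) ^ γ * h t) →
    Measurable p → (∀ s, 0 ≤ p s) →
    (∀ s, 0 < s → s ≤ T → p s ≤ C1 * (A * (h s * s) + B * h T * (s / T) ^ (β + 1))) →
    (∀ s, T < s → p s ≤ C1 * (B * h T)) →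
    (∀ s, 0 < s → s ≤ T → C2 * A * (h s * s) ≤ p s) →
    (∀ s, T < s → s ≤ K * T → C2 * B * h T ≤ p s) →
    C⁻¹ * (A * (∫ s in Set.Ioc (0:ℝ) T, h s * levyTail ν s) + B * h T * levyTail ν T) ≤ ∫ s, p s ∂ν ∧
    ∫ s, p s ∂ν ≤ C * (A * (∫ s in Set.Ioc (0:ℝ) T, h s * levyTail ν s) + B * h T * levyTail ν T) := by
  have hK0 : 0 < K := by linarith
  set C6 : ℝ := 2 * C3 * K ^ γ + C3 * K ^ γ * (c * K ^ β) with hC6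
  have hC60 : 0 < C6 := by positivity
  refine ⟨1 + C1 * (c * (β + 1) + 1) + 2 * (C6 + 1) / C2, ?_, ?_⟩
  · have : 0 ≤ C1 * (c * (β + 1) + 1) := by positivity
    have : 0 ≤ 2 * (C6 + 1) / C2 := by positivity
    linarith
  intro T A B h p hT hA hB hAB hw hg ha h0 h1 hh hpm hp0 hup1 hup2 hlo1 hlo2
  have hwT := jk_tail_nonneg ν T
  have hhT := h0 T
  set C : ℝ := 1 + C1 * (c * (β + 1) + 1) + 2 * (C6 + 1) / C2 with hC
  have hCa : C1 * (c * (β + 1) + 1) ≤ C := by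
    have : 0 ≤ 2 * (C6 + 1) / C2 := by positivity
    linarith
  have hCb : 2 * (C6 + 1) / C2 ≤ C := by
    have : 0 ≤ C1 * (c * (β + 1) + 1) := by positivity
    linarith
  have hC0 : 0 < C := lt_of_lt_of_le (by positivity) hCb
  -- the integral of `h w`
  set I : ℝ := ∫ s in Set.Ioc (0:ℝ) T, h s * levyTail ν s with hI
  have hwm : AntitoneOn (levyTail ν) (Set.Ioc 0 T) := fun u hu v _ huv => jk_tail_anti hν hu.1 huv
  have hmeas : AEMeasurable (fun s => h s * levyTail ν s) (volume.restrict (Set.Ioc 0 T)) :=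
    ha.measurable.aemeasurable.mul (aemeasurable_restrict_of_antitoneOn measurableSet_Ioc hwm)
  have hIeq : I = (∫⁻ s in Set.Ioc (0:ℝ) T, ENNReal.ofReal (h s * levyTail ν s)).toReal := by
    rw [hI]
    exact integral_eq_lintegral_of_nonneg_ae
      (Filter.Eventually.of_forall fun s => mul_nonneg (h0 s) (jk_tail_nonneg ν s))
      hmeas.aestronglyMeasurable
  have hIfin : ∫⁻ s in Set.Ioc (0:ℝ) T, ENNReal.ofReal (h s * levyTail ν s) < ⊤ := by
    refine lt_of_le_of_lt (lintegral_mono fun s => ENNReal.ofReal_le_ofReal ?_) (jk_fin_tail hν T hT)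
    exact mul_le_of_le_one_left (jk_tail_nonneg ν s) (h1 s)
  have hIof : ∫⁻ s in Set.Ioc (0:ℝ) T, ENNReal.ofReal (h s * levyTail ν s) = ENNReal.ofReal I := by
    rw [hIeq, ENNReal.ofReal_toReal hIfin.ne]
  have hI0 : 0 ≤ I := by rw [hIeq]; exact ENNReal.toReal_nonneg
  -- the integral of `h(s) s`
  have hX1 := jk_upper1 hν T h ha h0
  rw [hIof] at hX1
  have hXfin : ∫⁻ s in Set.Ioc 0 T, ENNReal.ofReal (h s * s) ∂ν ≠ ⊤ :=
    (hX1.trans_lt ENNReal.ofReal_lt_top).ne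
  set X : ℝ := (∫⁻ s in Set.Ioc 0 T, ENNReal.ofReal (h s * s) ∂ν).toReal with hXdef
  have hXof : ∫⁻ s in Set.Ioc 0 T, ENNReal.ofReal (h s * s) ∂ν = ENNReal.ofReal X := by
    rw [hXdef, ENNReal.ofReal_toReal hXfin]
  have hX0 : 0 ≤ X := ENNReal.toReal_nonneg
  have hXI : X ≤ I := by
    rw [hXof] at hX1; exact (ENNReal.ofReal_le_ofReal_iff hI0).1 hX1
  have hIX : I ≤ 2 * C3 * K ^ γ * X + C3 * K ^ γ * (c * K ^ β) * (T * h T * levyTail ν T) := by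
    have := jk_lower hν T hT c β K C3 γ hβ hK hC3 hγ hc hw hg h ha h0 hh
    rw [hIof, hXof, ← ENNReal.ofReal_mul (by positivity),
      ← ENNReal.ofReal_add (by positivity) (by positivity)] at this
    exact (ENNReal.ofReal_le_ofReal_iff (by positivity)).1 this
  have hhm : Measurable fun s => ENNReal.ofReal (h s * s) :=
    (ha.measurable.mul measurable_id).ennreal_ofReal
  -- split
  have hsplit : ∫⁻ s, ENNReal.ofReal (p s) ∂ν = (∫⁻ s in Set.Ioc 0 T, ENNReal.ofReal (p s) ∂ν) +
      ∫⁻ s in Set.Ioi T, ENNReal.ofReal (p s) ∂ν := by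
    rw [← lintegral_union measurableSet_Ioi (Set.Ioc_disjoint_Ioi le_rfl),
      Set.Ioc_union_Ioi_eq_Ioi hT.le]
    rw [← lintegral_add_compl _ (measurableSet_Ioi : MeasurableSet (Set.Ioi (0:ℝ))), Set.compl_Ioi,
      Measure.restrict_eq_zero.2 hν.supp, lintegral_zero_measure, add_zero]
  have hup : ∫⁻ s, ENNReal.ofReal (p s) ∂ν ≤
      ENNReal.ofReal (C * (A * I + B * h T * levyTail ν T)) := by
    rw [hsplit]
    have u1 : ∫⁻ s in Set.Ioc 0 T, ENNReal.ofReal (p s) ∂ν ≤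
        ENNReal.ofReal (C1 * A * X + C1 * B * h T * (c * (β + 1) * levyTail ν T)) := by
      calc ∫⁻ s in Set.Ioc 0 T, ENNReal.ofReal (p s) ∂ν
          ≤ ∫⁻ s in Set.Ioc 0 T, (ENNReal.ofReal (C1 * A) * ENNReal.ofReal (h s * s) +
              ENNReal.ofReal (C1 * B * h T) * ENNReal.ofReal ((s / T) ^ (β + 1))) ∂ν := by
            refine setLIntegral_mono' measurableSet_Ioc fun s hs => ?_
            have hs0 := hs.1
            have := h0 s
            rw [← ENNReal.ofReal_mul (by positivity), ← ENNReal.ofReal_mul (by positivity),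
              ← ENNReal.ofReal_add (by positivity) (by positivity)]
            refine ENNReal.ofReal_le_ofReal ((hup1 s hs.1 hs.2).trans_eq (by ring))
        _ = ENNReal.ofReal (C1 * A) * ENNReal.ofReal X + ENNReal.ofReal (C1 * B * h T) *
              ∫⁻ s in Set.Ioc 0 T, ENNReal.ofReal ((s / T) ^ (β + 1)) ∂ν := by
            rw [lintegral_add_left (hhm.const_mul _), lintegral_const_mul _ hhm, hXof,
              lintegral_const_mul _ (by fun_prop)]
        _ ≤ ENNReal.ofReal (C1 * A) * ENNReal.ofReal X + ENNReal.ofReal (C1 * B * h T) *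
              ENNReal.ofReal (c * (β + 1) * levyTail ν T) := by
            gcongr; exact jk_upper2 hν T hT c β hβ hw
        _ = _ := by
            rw [← ENNReal.ofReal_mul (by positivity), ← ENNReal.ofReal_mul (by positivity),
              ← ENNReal.ofReal_add (by positivity) (by positivity)]
    have u2 : ∫⁻ s in Set.Ioi T, ENNReal.ofReal (p s) ∂ν ≤
        ENNReal.ofReal (C1 * (B * h T) * levyTail ν T) := by
      calc ∫⁻ s in Set.Ioi T, ENNReal.ofReal (p s) ∂ν
          ≤ ∫⁻ s in Set.Ioi T, ENNReal.ofReal (C1 * (B * h T)) ∂ν :=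
            setLIntegral_mono' measurableSet_Ioi fun s hs => ENNReal.ofReal_le_ofReal (hup2 s hs)
        _ = _ := by
          rw [setLIntegral_const, ← jk_ofReal_tail hν hT, ← ENNReal.ofReal_mul (by positivity)]
    refine (add_le_add u1 u2).trans ?_
    rw [← ENNReal.ofReal_add (by positivity) (by positivity)]
    refine ENNReal.ofReal_le_ofReal ?_
    have e1 : C1 * A * X ≤ C1 * (c * (β + 1) + 1) * (A * I) := by
      have q : C1 * (A * X) ≤ C1 * (A * I) := by gcongr
      have q2 : 0 ≤ C1 * (c * (β + 1)) * (A * I) := by positivity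
      linarith
    have e2 : C1 * (c * (β + 1) + 1) * (A * I + B * h T * levyTail ν T) ≤
        C * (A * I + B * h T * levyTail ν T) := by gcongr
    linarith
  have hJeq : ∫ s, p s ∂ν = (∫⁻ s, ENNReal.ofReal (p s) ∂ν).toReal :=
    integral_eq_lintegral_of_nonneg_ae (Filter.Eventually.of_forall hp0) hpm.aestronglyMeasurable
  have hJfin : ∫⁻ s, ENNReal.ofReal (p s) ∂ν ≠ ⊤ := (hup.trans_lt ENNReal.ofReal_lt_top).ne
  refine ⟨?_, ?_⟩
  · have l1 : ENNReal.ofReal (C2 * A * X) ≤ ∫⁻ s in Set.Ioc 0 T, ENNReal.ofReal (p s) ∂ν := by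
      rw [ENNReal.ofReal_mul (by positivity), ← hXof, ← lintegral_const_mul _ hhm]
      refine setLIntegral_mono' measurableSet_Ioc fun s hs => ?_
      rw [← ENNReal.ofReal_mul (by positivity)]
      exact ENNReal.ofReal_le_ofReal (hlo1 s hs.1 hs.2)
    have hKT : T ≤ K * T := le_mul_of_one_le_left hT.le hK
    have l2 : ENNReal.ofReal (C2 * B * h T * (levyTail ν T / 2)) ≤
        ∫⁻ s in Set.Ioi T, ENNReal.ofReal (p s) ∂ν := by
      calc ENNReal.ofReal (C2 * B * h T * (levyTail ν T / 2))
          ≤ ENNReal.ofReal (C2 * B * h T) * ν (Set.Ioc T (K * T)) := by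
            rw [ENNReal.ofReal_mul (by positivity)]
            gcongr
            exact jk_half hν hT hKT (hg T hT le_rfl)
        _ = ∫⁻ s in Set.Ioc T (K * T), ENNReal.ofReal (C2 * B * h T) ∂ν := by rw [setLIntegral_const]
        _ ≤ ∫⁻ s in Set.Ioc T (K * T), ENNReal.ofReal (p s) ∂ν :=
            setLIntegral_mono' measurableSet_Ioc fun s hs =>
              ENNReal.ofReal_le_ofReal (hlo2 s hs.1 hs.2)
        _ ≤ _ := lintegral_mono_set Set.Ioc_subset_Ioi_self
    have l3 : C2 * A * X + C2 * B * h T * (levyTail ν T / 2) ≤ ∫ s, p s ∂ν := by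
      rw [hJeq]
      refine (ENNReal.ofReal_le_iff_le_toReal hJfin).1 ?_
      rw [ENNReal.ofReal_add (by positivity) (by positivity), hsplit]
      exact add_le_add l1 l2
    rw [inv_mul_le_iff₀ hC0]
    have hJ0 : 0 ≤ ∫ s, p s ∂ν := le_trans (by positivity) l3
    refine le_trans ?_ (mul_le_mul_of_nonneg_right hCb hJ0)
    rw [div_mul_eq_mul_div, le_div_iff₀ hC2]
    refine le_trans ?_ (mul_le_mul_of_nonneg_left l3 (by positivity))
    have f1 : A * I ≤ 2 * C3 * K ^ γ * (A * X) +
        C3 * K ^ γ * (c * K ^ β) * (B * h T * levyTail ν T) := by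
      calc A * I ≤ A * (2 * C3 * K ^ γ * X +
            C3 * K ^ γ * (c * K ^ β) * (T * h T * levyTail ν T)) := by gcongr
        _ = 2 * C3 * K ^ γ * (A * X) +
            C3 * K ^ γ * (c * K ^ β) * ((A * T) * h T * levyTail ν T) := by ring
        _ ≤ _ := by gcongr
    have f2 : A * I ≤ C6 * (A * X) + C6 * (B * h T * levyTail ν T) := by
      refine f1.trans ?_
      gcongr
      · rw [hC6]; have : 0 ≤ C3 * K ^ γ * (c * K ^ β) := by positivity
        linarith
      · rw [hC6]; have : 0 ≤ 2 * C3 * K ^ γ := by positivity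
        linarith
    have f3 : 0 ≤ A * X := by positivity
    have f4 : 0 ≤ B * h T * levyTail ν T := by positivity
    have f5 : A * I + B * h T * levyTail ν T ≤
        2 * (C6 + 1) * (A * X + B * h T * levyTail ν T / 2) := by nlinarith
    calc (A * I + B * h T * levyTail ν T) * C2
        ≤ (2 * (C6 + 1) * (A * X + B * h T * levyTail ν T / 2)) * C2 := by gcongr
      _ = _ := by ring
  · rw [hJeq]
    exact ENNReal.toReal_le_of_le_ofReal (by positivity) hup

theorem jk_exp (c q : ℝ) (hc : 0 < c) :
    ∃ M : ℝ, 0 < M ∧ ∀ z : ℝ, 1 ≤ z → z ^ q * Real.exp (-(c * z ^ 2)) ≤ M := by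
  obtain ⟨n, hn⟩ := exists_nat_ge q
  refine ⟨n.factorial / c ^ n, by positivity, fun z hz => ?_⟩
  have hz0 : 0 < z := by linarith
  have h1 : z ^ q ≤ (z ^ 2) ^ n := by
    calc z ^ q ≤ z ^ (n : ℝ) := Real.rpow_le_rpow_of_exponent_le hz hn
      _ = z ^ n := Real.rpow_natCast _ _
      _ ≤ z ^ (2 * n) := pow_le_pow_right₀ hz (by omega)
      _ = (z ^ 2) ^ n := pow_mul _ _ _
  have h2 : (c * z ^ 2) ^ n / n.factorial ≤ Real.exp (c * z ^ 2) :=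
    Real.pow_div_factorial_le_exp _ (by positivity) n
  rw [Real.exp_neg, ← div_eq_mul_inv, div_le_iff₀ (Real.exp_pos _)]
  refine h1.trans ?_
  have h3 : (z ^ 2) ^ n = (n.factorial / c ^ n : ℝ) * ((c * z ^ 2) ^ n / n.factorial) := by
    rw [mul_pow]; have : (n.factorial : ℝ) ≠ 0 := by positivity
    field_simp
  rw [h3]
  gcongr

theorem jk_small (CV d cA cA' α₁ α₂ cH γ cl cexl cu cexu β K : ℝ) (hCV : 1 ≤ CV) (hd : 0 < d)
    (hcA : 0 < cA) (hcA' : 0 < cA') (hα₁ : 0 < α₁) (hcH : 0 < cH)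
    (hγ : 0 ≤ γ) (hcl : 0 < cl) (hcexl : 0 < cexl) (hcu : 0 < cu) (hcexu : 0 < cexu)
    (hβ : 0 < β) (hK : 1 ≤ K) :
    ∃ C1 C2 : ℝ, 0 < C1 ∧ 0 < C2 ∧ ∀ r ρ s T V Vs H hs hT p C₀ : ℝ, 0 < r → 0 < ρ → 0 < s → 0 < T →
      0 < V → 0 < Vs → T ≤ H → 0 ≤ hs → 0 ≤ hT → (C₀ = 0 ∨ C₀ = 1) →
      cl * hs * min Vs⁻¹ (C₀ * s / (V * H) + Vs⁻¹ * Real.exp (-(cexl * r ^ 2 / ρ ^ 2))) ≤ p →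
      p ≤ cu * hs * min Vs⁻¹ (C₀ * s / (V * H) + Vs⁻¹ * Real.exp (-(cexu * r ^ 2 / ρ ^ 2))) →
      (s ≤ T → ρ ≤ r ∧ Vs ≤ V ∧ V ≤ CV * (r / ρ) ^ d * Vs ∧ T / s ≤ cA' * (r / ρ) ^ α₂ ∧
        hs ≤ cH * (T / s) ^ γ * hT) →
      (T < s → r ≤ ρ ∧ V ≤ Vs ∧ Vs ≤ CV * (ρ / r) ^ d * V ∧ cA * (ρ / r) ^ α₁ ≤ s / T ∧
        hs ≤ hT ∧ hT ≤ cH * (s / T) ^ γ * hs) →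
      (s ≤ T → p ≤ C1 * (C₀ / (V * H) * (hs * s) + V⁻¹ * hT * (s / T) ^ (β + 1))) ∧
      (T < s → p ≤ C1 * (V⁻¹ * hT)) ∧
      (s ≤ T → C2 * (C₀ / (V * H)) * (hs * s) ≤ p) ∧
      (T < s → s ≤ K * T → C2 * V⁻¹ * hT ≤ p) := by
  have hK0 : 0 < K := by linarith
  have hCV0 : 0 < CV := by linarith
  set n : ℝ := β + 1 + γ with hn
  have hn0 : 0 < n := by linarith
  obtain ⟨M, hM, hMz⟩ := jk_exp cexu (d + α₂ * n) hcexu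
  set L : ℝ := (K / cA) ^ (1 / α₁) with hL
  have hL0 : 0 < L := by positivity
  set Q : ℝ := CV * L ^ d * (cH * K ^ γ) with hQ
  have hQ0 : 0 < Q := by positivity
  have hP0 : 0 < cH * CV * M * cA' ^ n := by positivity
  refine ⟨cu * (1 + cH * CV * M * cA' ^ n), min cl (cl * Real.exp (-cexl) / Q), by positivity,
    lt_min hcl (by positivity), ?_⟩
  intro r ρ s T V Vs H hs hT p C₀ hr hρ hs0 hT0 hV hVs hTH hhs hhT hC₀ hlow hupp hA hB
  have hH : 0 < H := by linarith
  have hC₀0 : 0 ≤ C₀ := by rcases hC₀ with h | h <;> rw [h]; exact zero_le_one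
  refine ⟨fun hsT => ?_, fun hTs => ?_, fun hsT => ?_, fun hTs hsK => ?_⟩
  · obtain ⟨h1, h2, h3, h4, h5⟩ := hA hsT
    set z := r / ρ with hz
    have hz1 : 1 ≤ z := (one_le_div hρ).2 h1
    have hz0 : 0 < z := by linarith
    have hzz : cexu * r ^ 2 / ρ ^ 2 = cexu * z ^ 2 := by rw [hz]; field_simp
    have k1 : Vs⁻¹ ≤ CV * z ^ d * V⁻¹ := by
      rw [inv_eq_one_div, div_le_iff₀ hVs]
      have : CV * z ^ d * V⁻¹ * Vs = (CV * z ^ d * Vs) / V := by field_simp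
      rw [this, one_le_div hV]; exact h3
    have k2 : z ^ d * Real.exp (-(cexu * z ^ 2)) ≤ M * (cA' ^ n * (s / T) ^ n) := by
      have e1 : z ^ d = z ^ (d + α₂ * n) * (z ^ (α₂ * n))⁻¹ := by
        rw [Real.rpow_add hz0]; have := (Real.rpow_pos_of_pos hz0 (α₂ * n)).ne'
        field_simp
      have e2 : (z ^ (α₂ * n))⁻¹ ≤ cA' ^ n * (s / T) ^ n := by
        rw [← Real.mul_rpow hcA'.le (by positivity), Real.rpow_mul hz0.le, ← Real.inv_rpow (by positivity)]
        refine Real.rpow_le_rpow (by positivity) ?_ hn0.le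
        have := Real.rpow_pos_of_pos hz0 α₂
        rw [inv_le_iff_one_le_mul₀ this]
        have e3 : T ≤ cA' * z ^ α₂ * s := by rwa [div_le_iff₀ hs0] at h4
        have e4 : cA' * (s / T) * z ^ α₂ = (cA' * z ^ α₂ * s) / T := by ring
        rw [e4, one_le_div hT0]; exact e3
      calc z ^ d * Real.exp (-(cexu * z ^ 2))
          = (z ^ (d + α₂ * n) * Real.exp (-(cexu * z ^ 2))) * (z ^ (α₂ * n))⁻¹ := by
            rw [e1]; ring
        _ ≤ M * (cA' ^ n * (s / T) ^ n) := by
            gcongr; exact hMz z hz1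
    have k3 : hs * (s / T) ^ n ≤ cH * hT * (s / T) ^ (β + 1) := by
      calc hs * (s / T) ^ n ≤ (cH * (T / s) ^ γ * hT) * (s / T) ^ n := by gcongr
        _ = cH * hT * (s / T) ^ (β + 1) * ((T / s) ^ γ * (s / T) ^ γ) := by
            rw [hn, Real.rpow_add (by positivity : 0 < s / T) (β + 1) γ]; ring
        _ = cH * hT * (s / T) ^ (β + 1) := by
            rw [← Real.mul_rpow (by positivity) (by positivity)]
            have : T / s * (s / T) = 1 := by field_simp
            rw [this, Real.one_rpow, mul_one]
    rw [hzz] at hupp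
    calc p ≤ cu * hs * (C₀ * s / (V * H) + Vs⁻¹ * Real.exp (-(cexu * z ^ 2))) :=
          hupp.trans (by gcongr; exact min_le_right _ _)
      _ ≤ cu * hs * (C₀ * s / (V * H) + CV * z ^ d * V⁻¹ * Real.exp (-(cexu * z ^ 2))) := by gcongr
      _ = cu * (C₀ / (V * H) * (hs * s)) +
            cu * CV * V⁻¹ * hs * (z ^ d * Real.exp (-(cexu * z ^ 2))) := by ring
      _ ≤ cu * (C₀ / (V * H) * (hs * s)) +
            cu * CV * V⁻¹ * hs * (M * (cA' ^ n * (s / T) ^ n)) := by gcongr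
      _ = cu * (C₀ / (V * H) * (hs * s)) +
            cu * CV * V⁻¹ * M * cA' ^ n * (hs * (s / T) ^ n) := by ring
      _ ≤ cu * (C₀ / (V * H) * (hs * s)) +
            cu * CV * V⁻¹ * M * cA' ^ n * (cH * hT * (s / T) ^ (β + 1)) := by gcongr
      _ ≤ cu * (1 + cH * CV * M * cA' ^ n) *
            (C₀ / (V * H) * (hs * s) + V⁻¹ * hT * (s / T) ^ (β + 1)) := by
          have q1 : 0 ≤ C₀ / (V * H) * (hs * s) := by positivity
          have q2 : 0 ≤ V⁻¹ * hT * (s / T) ^ (β + 1) := by positivity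
          have q3 : 0 ≤ cu * (cH * CV * M * cA' ^ n) * (C₀ / (V * H) * (hs * s)) := by positivity
          have q4 : 0 ≤ cu * (V⁻¹ * hT * (s / T) ^ (β + 1)) := by positivity
          linarith
  · obtain ⟨h1, h2, h3, h4, h5, h6⟩ := hB hTs
    calc p ≤ cu * hs * Vs⁻¹ := hupp.trans (by gcongr; exact min_le_left _ _)
      _ ≤ cu * hT * V⁻¹ := by gcongr
      _ = cu * 1 * (V⁻¹ * hT) := by ring
      _ ≤ _ := by gcongr; linarith
  · obtain ⟨h1, h2, h3, h4, h5⟩ := hA hsT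
    have k1 : C₀ / (V * H) * s ≤ Vs⁻¹ := by
      have k2 : C₀ ≤ 1 := by rcases hC₀ with h | h <;> rw [h]; exact zero_le_one
      calc C₀ / (V * H) * s ≤ 1 / (V * H) * H := by gcongr; linarith
        _ = V⁻¹ := by field_simp
        _ ≤ Vs⁻¹ := by gcongr
    calc min cl (cl * Real.exp (-cexl) / Q) * (C₀ / (V * H)) * (hs * s)
        ≤ cl * (C₀ / (V * H)) * (hs * s) := by gcongr; exact min_le_left _ _
      _ = cl * hs * (C₀ / (V * H) * s) := by ring
      _ ≤ cl * hs * min Vs⁻¹ (C₀ * s / (V * H) + Vs⁻¹ * Real.exp (-(cexl * r ^ 2 / ρ ^ 2))) := by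
          gcongr
          refine le_min k1 ?_
          have : 0 ≤ Vs⁻¹ * Real.exp (-(cexl * r ^ 2 / ρ ^ 2)) := by positivity
          have e : C₀ / (V * H) * s = C₀ * s / (V * H) := by ring
          linarith
      _ ≤ p := hlow
  · obtain ⟨h1, h2, h3, h4, h5, h6⟩ := hB hTs
    have hsK' : s / T ≤ K := (div_le_iff₀ hT0).2 hsK
    have k1 : ρ / r ≤ L := by
      have e1 : (ρ / r) ^ α₁ ≤ K / cA := by
        rw [le_div_iff₀ hcA]; linarith
      have e2 := Real.rpow_le_rpow (by positivity) e1 (by positivity : (0:ℝ) ≤ 1 / α₁)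
      rwa [← Real.rpow_mul (by positivity), mul_one_div_cancel hα₁.ne', Real.rpow_one] at e2
    have k2 : Vs ≤ CV * L ^ d * V := h3.trans (by gcongr)
    have k3 : hT ≤ cH * K ^ γ * hs := h6.trans (by gcongr)
    have k4 : V⁻¹ ≤ CV * L ^ d * Vs⁻¹ := by
      rw [inv_eq_one_div, div_le_iff₀ hV]
      have : CV * L ^ d * Vs⁻¹ * V = (CV * L ^ d * V) / Vs := by field_simp
      rw [this, one_le_div hVs]; exact k2
    have k5 : Real.exp (-cexl) ≤ Real.exp (-(cexl * r ^ 2 / ρ ^ 2)) := by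
      refine Real.exp_le_exp.2 (neg_le_neg ?_)
      rw [div_le_iff₀ (by positivity)]
      gcongr
    have k6 : Real.exp (-cexl) ≤ 1 := Real.exp_le_one_iff.2 (by linarith)
    calc min cl (cl * Real.exp (-cexl) / Q) * V⁻¹ * hT
        ≤ (cl * Real.exp (-cexl) / Q) * (CV * L ^ d * Vs⁻¹) * (cH * K ^ γ * hs) := by
          gcongr; exact min_le_right _ _
      _ = cl * hs * (Vs⁻¹ * Real.exp (-cexl)) * ((CV * L ^ d * (cH * K ^ γ)) / Q) := by ring
      _ = cl * hs * (Vs⁻¹ * Real.exp (-cexl)) := by rw [← hQ, div_self hQ0.ne', mul_one]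
      _ ≤ cl * hs * min Vs⁻¹ (C₀ * s / (V * H) + Vs⁻¹ * Real.exp (-(cexl * r ^ 2 / ρ ^ 2))) := by
          gcongr
          refine le_min (mul_le_of_le_one_right (by positivity) k6) ?_
          have q : 0 ≤ C₀ * s / (V * H) := by positivity
          have q2 : Vs⁻¹ * Real.exp (-cexl) ≤ Vs⁻¹ * Real.exp (-(cexl * r ^ 2 / ρ ^ 2)) := by gcongr
          linarith
      _ ≤ p := hlow

theorem jk_large (T0 Vlo Vhi cH γ c5 c6 lam β K : ℝ) (hT00 : 0 < T0) (hVlo : 0 < Vlo)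
    (hVhi : 0 < Vhi) (hcH : 0 < cH)
    (hγ : 0 ≤ γ) (hc5 : 0 < c5) (hc6 : 0 < c6) (hlam : 0 < lam)
    (hβ : 0 < β) (hK : 1 ≤ K) :
    ∃ C1 C2 : ℝ, 0 < C1 ∧ 0 < C2 ∧ ∀ s T V H hs hT h1 p C₀ : ℝ, 1 < s → 0 < T → T ≤ T0 →
      0 < V → V ≤ Vhi → (1 ≤ K * T → Vlo ≤ V) → T ≤ H → 0 ≤ hs → 0 ≤ hT → 0 ≤ h1 →
      (C₀ = 0 ∨ C₀ = 1) → hs ≤ h1 →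
      c5 * Real.exp (-(lam * s)) * h1 ≤ p →
      p ≤ c6 * Real.exp (-(lam * s)) * h1 →
      (T ≤ 1 → h1 ≤ hT ∧ hT ≤ cH * (1 / T) ^ γ * h1) →
      (1 ≤ T → hT ≤ h1 ∧ h1 ≤ cH * (T / 1) ^ γ * hT) →
      (s ≤ T → p ≤ C1 * (C₀ / (V * H) * (hs * s) + V⁻¹ * hT * (s / T) ^ (β + 1))) ∧
      (T < s → p ≤ C1 * (V⁻¹ * hT)) ∧
      (s ≤ T → C2 * (C₀ / (V * H)) * (hs * s) ≤ p) ∧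
      (T < s → s ≤ K * T → C2 * V⁻¹ * hT ≤ p) := by
  have hK0 : 0 < K := by linarith
  set G : ℝ := 1 + cH * T0 ^ γ with hG
  set G2 : ℝ := 1 + cH * K ^ γ with hG2
  have hG0 : 0 < G := by positivity
  have hG20 : 0 < G2 := by positivity
  have hGG : 1 ≤ G2 := by rw [hG2]; have : 0 < cH * K ^ γ := by positivity
                          linarith
  set C2 : ℝ := c5 * Real.exp (-(lam * (K * T0))) * Vlo / G2 with hC2
  set m1 : ℝ := max 1 (T0 ^ (β + 1)) with hm1
  have hm10 : 0 < m1 := lt_max_of_lt_left one_pos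
  refine ⟨c6 * G * Vhi * m1, C2, by positivity, by positivity, ?_⟩
  intro s T V H hs hT h1 p C₀ hs1 hT0 hTT hV hVV hVl hTH hhs hhT hh1 hC₀ hsh hlow hupp hA hB
  have hH : 0 < H := by linarith
  have hs0 : 0 < s := by linarith
  have hC₀0 : 0 ≤ C₀ := by rcases hC₀ with h | h <;> rw [h]; exact zero_le_one
  have hC₀1 : C₀ ≤ 1 := by rcases hC₀ with h | h <;> rw [h]; exact zero_le_one
  have a1 : h1 ≤ G * hT := by
    rcases le_total T 1 with h | h
    · refine (hA h).1.trans ?_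
      have : 0 ≤ cH * T0 ^ γ * hT := by positivity
      rw [hG]; linarith
    · refine (hB h).2.trans ?_
      have : cH * (T / 1) ^ γ * hT ≤ cH * T0 ^ γ * hT := by rw [div_one]; gcongr
      rw [hG]; linarith
  have a2 : p ≤ c6 * G * Vhi * (V⁻¹ * hT) := by
    have e : Real.exp (-(lam * s)) ≤ 1 := Real.exp_le_one_iff.2 (by have := mul_pos hlam hs0; linarith)
    have e2 : 1 ≤ Vhi * V⁻¹ := by rw [← div_eq_mul_inv, one_le_div hV]; exact hVV
    calc p ≤ c6 * 1 * (G * hT) := hupp.trans (by gcongr)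
      _ = c6 * G * hT * 1 := by ring
      _ ≤ c6 * G * hT * (Vhi * V⁻¹) := by gcongr
      _ = _ := by ring
  refine ⟨fun hsT => ?_, fun hTs => ?_, fun hsT => ?_, fun hTs hsK => ?_⟩
  · have e1 : 1 ≤ m1 * (s / T) ^ (β + 1) := by
      calc 1 ≤ (T0 * (s / T)) ^ (β + 1) := by
            refine Real.one_le_rpow ?_ (by linarith)
            rw [← mul_div_assoc, one_le_div hT0]
            nlinarith
        _ = T0 ^ (β + 1) * (s / T) ^ (β + 1) := Real.mul_rpow hT00.le (by positivity)
        _ ≤ _ := by gcongr; exact le_max_right _ _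
    calc p ≤ c6 * G * Vhi * (V⁻¹ * hT) * 1 := by rw [mul_one]; exact a2
      _ ≤ c6 * G * Vhi * (V⁻¹ * hT) * (m1 * (s / T) ^ (β + 1)) := by gcongr
      _ = c6 * G * Vhi * m1 * (0 + V⁻¹ * hT * (s / T) ^ (β + 1)) := by ring
      _ ≤ _ := by gcongr; positivity
  · calc p ≤ c6 * G * Vhi * (V⁻¹ * hT) * 1 := by rw [mul_one]; exact a2
      _ ≤ c6 * G * Vhi * (V⁻¹ * hT) * m1 := by gcongr; exact le_max_left _ _
      _ = _ := by ring
  · have hKT : T ≤ K * T := le_mul_of_one_le_left hT0.le hK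
    have hVl' := hVl (by linarith)
    have e1 : C₀ / (V * H) * s ≤ Vlo⁻¹ := by
      calc C₀ / (V * H) * s ≤ 1 / (V * H) * H := by gcongr; linarith
        _ = V⁻¹ := by field_simp
        _ ≤ Vlo⁻¹ := by gcongr
    have e2 : Real.exp (-(lam * (K * T0))) ≤ Real.exp (-(lam * s)) := by
      refine Real.exp_le_exp.2 (neg_le_neg ?_)
      gcongr
      calc s ≤ K * T := by linarith
        _ ≤ K * T0 := by gcongr
    calc C2 * (C₀ / (V * H)) * (hs * s) = C2 * hs * (C₀ / (V * H) * s) := by ring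
      _ ≤ C2 * h1 * Vlo⁻¹ := by gcongr
      _ = c5 * Real.exp (-(lam * (K * T0))) * h1 / G2 := by rw [hC2]; field_simp
      _ ≤ c5 * Real.exp (-(lam * (K * T0))) * h1 := div_le_self (by positivity) hGG
      _ ≤ c5 * Real.exp (-(lam * s)) * h1 := by gcongr
      _ ≤ p := hlow
  · have hVl' := hVl (by linarith)
    have e2 : Real.exp (-(lam * (K * T0))) ≤ Real.exp (-(lam * s)) := by
      refine Real.exp_le_exp.2 (neg_le_neg ?_)
      gcongr
      calc s ≤ K * T := by linarith
        _ ≤ K * T0 := by gcongr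
    have e3 : hT ≤ G2 * h1 := by
      rcases le_total T 1 with h | h
      · refine (hA h).2.trans ?_
        have k : 1 / T ≤ K := by rw [div_le_iff₀ hT0]; linarith
        have : cH * (1 / T) ^ γ * h1 ≤ cH * K ^ γ * h1 := by gcongr
        rw [hG2]; linarith
      · refine (hB h).1.trans ?_
        exact le_mul_of_one_le_left hh1 hGG
    calc C2 * V⁻¹ * hT ≤ C2 * Vlo⁻¹ * (G2 * h1) := by gcongr
      _ = c5 * Real.exp (-(lam * (K * T0))) * h1 := by rw [hC2]; field_simp
      _ ≤ c5 * Real.exp (-(lam * s)) * h1 := by gcongr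
      _ ≤ p := hlow

theorem jk_tail_pos {ν : Measure ℝ} {R₁ : ℝ≥0∞} {c c' β₁ β₂ : ℝ} (hP : PolyCond ν R₁ c c' β₁ β₂)
    (hc : 0 < c) {R : ℝ} (hR : 0 < R) (hR1 : ENNReal.ofReal R < R₁) : 0 < levyTail ν R := by
  have h := (hP R R hR le_rfl hR1).1
  rw [div_self hR.ne', Real.one_rpow, mul_one] at h
  refine lt_of_le_of_ne (jk_tail_nonneg ν R) fun h0 => ?_
  rw [← h0, div_zero] at h
  linarith

theorem jk_tail_scale {ν : Measure ℝ} {R₁ : ℝ≥0∞} {c c' β₁ β₂ : ℝ} (hP : PolyCond ν R₁ c c' β₁ β₂)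
    (hc : 0 < c) {u T : ℝ} (hu : 0 < u) (huT : u ≤ T) (hR1 : ENNReal.ofReal T < R₁) :
    levyTail ν u ≤ c' * (T / u) ^ β₂ * levyTail ν T := by
  have h := (hP u T hu huT hR1).2
  rwa [div_le_iff₀ (jk_tail_pos hP hc (hu.trans_le huT) hR1)] at h

theorem jk_K0 {ν : Measure ℝ} {R₁ : ℝ≥0∞} {c c' β₁ β₂ : ℝ} (hP : PolyCond ν R₁ c c' β₁ β₂)
    (hc : 0 < c) (hβ : 0 < β₁) : ∃ K : ℝ, 1 ≤ K ∧ ∀ u, 0 < u → ENNReal.ofReal (K * u) < R₁ →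
      levyTail ν (K * u) ≤ levyTail ν u / 2 := by
  refine ⟨max 1 ((2 / c) ^ (1 / β₁)), le_max_left _ _, fun u hu hR => ?_⟩
  set K := max 1 ((2 / c) ^ (1 / β₁)) with hK
  have hK1 : 1 ≤ K := le_max_left _ _
  have hK0 : 0 < K := by linarith
  have h2 : 2 ≤ c * K ^ β₁ := by
    have : 2 / c ≤ K ^ β₁ := by
      calc 2 / c = ((2 / c) ^ (1 / β₁)) ^ β₁ := by
            rw [← Real.rpow_mul (by positivity), one_div_mul_cancel hβ.ne', Real.rpow_one]
        _ ≤ K ^ β₁ := Real.rpow_le_rpow (by positivity) (le_max_right _ _) hβ.le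
    rw [div_le_iff₀ hc] at this; linarith
  have h := (hP u (K * u) hu (le_mul_of_one_le_left hu.le hK1) hR).1
  rw [mul_div_cancel_right₀ _ hu.ne', le_div_iff₀ (jk_tail_pos hP hc (by positivity) hR)] at h
  have := jk_tail_nonneg ν (K * u)
  nlinarith

theorem jk_tail_tendsto {ν : Measure ℝ} (hν : IsLevyMeasure ν) {ε : ℝ} (hε : 0 < ε) :
    ∃ M : ℝ, 0 < M ∧ levyTail ν M ≤ ε := by
  have h1 : Filter.Tendsto (fun n : ℕ => ν (Set.Ioi ((n:ℝ) + 1))) Filter.atTop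
      (nhds (ν (⋂ n : ℕ, Set.Ioi ((n:ℝ) + 1)))) := by
    refine tendsto_measure_iInter_atTop (fun n => measurableSet_Ioi.nullMeasurableSet) ?_ ?_
    · intro a b hab
      refine Set.Ioi_subset_Ioi ?_
      have : (a:ℝ) ≤ b := by exact_mod_cast hab
      linarith
    · exact ⟨0, (hν.tail_fin _ (by positivity)).ne⟩
  have h2 : (⋂ n : ℕ, Set.Ioi ((n:ℝ) + 1)) = ∅ := by
    refine Set.eq_empty_of_forall_notMem fun x hx => ?_
    obtain ⟨n, hn⟩ := exists_nat_ge x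
    have := Set.mem_iInter.1 hx n
    rw [Set.mem_Ioi] at this; linarith
  rw [h2, measure_empty] at h1
  have h3 := (ENNReal.tendsto_nhds_zero.1 h1) (ENNReal.ofReal ε) (by simpa using hε)
  obtain ⟨n, hn⟩ := h3.exists
  exact ⟨(n:ℝ) + 1, by positivity, ENNReal.toReal_le_of_le_ofReal hε.le hn⟩

theorem jk_K {ν : Measure ℝ} (hν : IsLevyMeasure ν) {R₁ : ℝ≥0∞} {c c' β₁ β₂ : ℝ}
    (hP : PolyCond ν R₁ c c' β₁ β₂)
    (hc : 0 < c) (hβ : 0 < β₁) (hR₁ : 0 < R₁) {T0 : ℝ} (hT0 : 0 < T0)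
    (hTR : ENNReal.ofReal T0 < R₁) : ∃ K : ℝ, 1 ≤ K ∧ ∀ u, 0 < u → u ≤ T0 →
      levyTail ν (K * u) ≤ levyTail ν u / 2 := by
  obtain ⟨K1, hK1, hK⟩ := jk_K0 hP hc hβ
  obtain ⟨M, hM, hMw⟩ := jk_tail_tendsto hν (half_pos (jk_tail_pos hP hc hT0 hTR))
  have hK10 : 0 < K1 := by linarith
  set T1 := T0 / K1 with hT1
  have hT10 : 0 < T1 := by positivity
  refine ⟨max K1 (M / T1), hK1.trans (le_max_left _ _), fun u hu huT => ?_⟩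
  rcases le_or_gt u T1 with h | h
  · have e : K1 * u ≤ T0 := by rw [hT1, le_div_iff₀ hK10] at h; linarith
    refine (jk_tail_anti hν (by positivity : 0 < K1 * u) ?_).trans
      (hK u hu ((ENNReal.ofReal_le_ofReal e).trans_lt hTR))
    gcongr; exact le_max_left _ _
  · have e : M ≤ max K1 (M / T1) * u := by
      calc M = M / T1 * T1 := by field_simp
        _ ≤ max K1 (M / T1) * u := by
            gcongr; exact le_max_right _ _
    refine (jk_tail_anti hν hM e).trans (hMw.trans ?_)
    have := jk_tail_anti hν hu huT
    linarith

theorem jk_H2 {s t γ c a b : ℝ} (hs : 0 < s) (ht : 0 < t) (h : s ^ γ * a ≤ c * (t ^ γ * b)) :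
    a ≤ c * (t / s) ^ γ * b := by
  have hsg := Real.rpow_pos_of_pos hs γ
  rw [Real.div_rpow ht.le hs.le]
  have : c * (t ^ γ / s ^ γ) * b = (c * (t ^ γ * b)) / s ^ γ := by ring
  rw [this, le_div_iff₀ hsg]; linarith

theorem jk_vol_pos {E : Type*} [PseudoMetricSpace E] [MeasurableSpace E] {m : Measure E}
    (hm : ∀ (x : E) (r : ℝ), 0 < r → 0 < m (Metric.ball x r) ∧ m (Metric.ball x r) < ⊤)
    (x : E) {r : ℝ} (hr : 0 < r) : 0 < vol m x r :=
  ENNReal.toReal_pos (hm x r hr).1.ne' (hm x r hr).2.ne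

theorem jk_vol_mono {E : Type*} [PseudoMetricSpace E] [MeasurableSpace E] {m : Measure E}
    (hm : ∀ (x : E) (r : ℝ), 0 < r → 0 < m (Metric.ball x r) ∧ m (Metric.ball x r) < ⊤)
    {x y : E} {r R : ℝ} (hR : 0 < R) (h : Metric.ball x r ⊆ Metric.ball y R) :
    vol m x r ≤ vol m y R :=
  ENNReal.toReal_mono (hm y R hR).2.ne (measure_mono h)

theorem jk_pt {E : Type*} [MetricSpace E] [MeasurableSpace E] (m : Measure E) (d₂ : ℝ)
    (hm : ∀ (x : E) (r : ℝ), 0 < r → 0 < m (Metric.ball x r) ∧ m (Metric.ball x r) < ⊤)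
    (hd₂ : 0 < d₂) (CV : ℝ) (hCV : 1 ≤ CV) (Pr : ℝ → Prop)
    (hVD : ∀ (x : E) (r R : ℝ), 0 < r → r ≤ R → Pr R → vol m x R ≤ CV * (R / r) ^ d₂ * vol m x r)
    (D : Set E) (Φ Ψ : ℝ → ℝ) (cA cA' α₁ α₂ : ℝ)
    (hΦ0 : Φ 0 = 0) (hΦmono : StrictMonoOn Φ (Set.Ici 0))
    (hΦΨ : ∀ r : ℝ, 0 ≤ r → Φ r ≤ Ψ r)
    (hcA : 0 < cA) (hcA' : 0 < cA') (hα₁ : 0 < α₁)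
    (hΦsc : WeakScaling Φ cA cA' α₁ α₂)
    (ΦInv : ℝ → ℝ) (hΦInv : ∀ s : ℝ, 0 < s → 0 < ΦInv s ∧ Φ (ΦInv s) = s)
    (h : ℝ → E → E → ℝ) (cH γ : ℝ) (hcH : 0 < cH) (hγ : 0 ≤ γ)
    (hh01 : ∀ (t : ℝ) (x y : E), 0 < t → x ∈ D → y ∈ D → h t x y ∈ Set.Icc (0:ℝ) 1)
    (hhm : ∀ (x y : E), x ∈ D → y ∈ D → ∀ s t : ℝ, 0 < s → s ≤ t → h t x y ≤ h s x y)
    (pD : ℝ → E → E → ℝ) (β K : ℝ) (hβ : 0 < β) (hK : 1 ≤ K)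
    (C₀ cl cexl cu cexu : ℝ) (hC₀ : C₀ = 0 ∨ C₀ = 1)
    (hcl : 0 < cl) (hcexl : 0 < cexl) (hcu : 0 < cu) (hcexu : 0 < cexu) (tcond : ℝ → Prop)
    (hHK : HKest m D Ψ ΦInv h pD C₀ cl cexl cu cexu tcond) :
    ∃ C1 C2 : ℝ, 0 < C1 ∧ 0 < C2 ∧ ∀ x y : E, x ∈ D → y ∈ D → x ≠ y → ∀ s : ℝ, 0 < s → tcond s →
      Pr (dist x y) → Pr (ΦInv s) →
      (s ≤ Φ (dist x y) → h s x y ≤ cH * (Φ (dist x y) / s) ^ γ * h (Φ (dist x y)) x y) →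
      (Φ (dist x y) < s → h (Φ (dist x y)) x y ≤ cH * (s / Φ (dist x y)) ^ γ * h s x y) →
      (s ≤ Φ (dist x y) → pD s x y ≤ C1 * (C₀ / (vol m x (dist x y) * Ψ (dist x y)) * (h s x y * s) +
        (vol m x (dist x y))⁻¹ * h (Φ (dist x y)) x y * (s / Φ (dist x y)) ^ (β + 1))) ∧
      (Φ (dist x y) < s → pD s x y ≤ C1 * ((vol m x (dist x y))⁻¹ * h (Φ (dist x y)) x y)) ∧
      (s ≤ Φ (dist x y) → C2 * (C₀ / (vol m x (dist x y) * Ψ (dist x y))) * (h s x y * s) ≤ pD s x y) ∧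
      (Φ (dist x y) < s → s ≤ K * Φ (dist x y) →
        C2 * (vol m x (dist x y))⁻¹ * h (Φ (dist x y)) x y ≤ pD s x y) := by
  obtain ⟨C1, C2, hC1, hC2, H⟩ := jk_small CV d₂ cA cA' α₁ α₂ cH γ cl cexl cu cexu β K hCV hd₂ hcA hcA'
    hα₁ hcH hγ hcl hcexl hcu hcexu hβ hK
  refine ⟨C1, C2, hC1, hC2, fun x y hx hy hxy s hs hts hP1 hP2 hh1 hh2 => ?_⟩
  have hr : 0 < dist x y := dist_pos.2 hxy
  have hT : 0 < Φ (dist x y) := by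
    rw [← hΦ0]; exact hΦmono Set.self_mem_Ici hr.le hr
  obtain ⟨hρ, hρs⟩ := hΦInv s hs
  obtain ⟨hl, hu⟩ := hHK s x y hs hts hx hy
  have hle := hΦmono.le_iff_le (a := ΦInv s) (b := dist x y) hρ.le hr.le
  rw [hρs] at hle
  refine H (dist x y) (ΦInv s) s (Φ (dist x y)) _ _ (Ψ (dist x y)) _ _ _ C₀ hr hρ hs hT
    (jk_vol_pos hm x hr) (jk_vol_pos hm x hρ) (hΦΨ _ hr.le) (hh01 s x y hs hx hy).1
    (hh01 _ x y hT hx hy).1 hC₀ hl hu ?_ ?_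
  · intro hsT
    have hρr := hle.1 hsT
    refine ⟨hρr, jk_vol_mono hm hr (Metric.ball_subset_ball hρr), hVD x _ _ hρ hρr hP1, ?_, hh1 hsT⟩
    have := (hΦsc _ _ hρ hρr).2
    rwa [hρs] at this
  · intro hTs
    have hρr : dist x y ≤ ΦInv s := by
      by_contra hcon
      push Not at hcon
      exact absurd (hle.2 hcon.le) (not_le.2 hTs)
    refine ⟨hρr, jk_vol_mono hm hρ (Metric.ball_subset_ball hρr), hVD x _ _ hr hρr hP2, ?_,
      hhm x y hx hy _ _ hT hTs.le, hh2 hTs⟩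
    have := (hΦsc _ _ hr hρr).1
    rwa [hρs] at this

theorem jk_final {E : Type*} [MetricSpace E] [MeasurableSpace E] (m : Measure E)
    (hm : ∀ (x : E) (r : ℝ), 0 < r → 0 < m (Metric.ball x r) ∧ m (Metric.ball x r) < ⊤)
    (D : Set E) (Φ Ψ : ℝ → ℝ)
    (hΦ0 : Φ 0 = 0) (hΦmono : StrictMonoOn Φ (Set.Ici 0))
    (hΦΨ : ∀ r : ℝ, 0 ≤ r → Φ r ≤ Ψ r)
    (h : ℝ → E → E → ℝ) (cH γ : ℝ) (hcH : 0 < cH) (hγ : 0 ≤ γ)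
    (hh01 : ∀ (t : ℝ) (x y : E), 0 < t → x ∈ D → y ∈ D → h t x y ∈ Set.Icc (0:ℝ) 1)
    (hhm : ∀ (x y : E), x ∈ D → y ∈ D → ∀ s t : ℝ, 0 < s → s ≤ t → h t x y ≤ h s x y)
    (pD : ℝ → E → E → ℝ) (hpD_meas : ∀ x y : E, Measurable fun s => pD s x y)
    (hpD_nonneg : ∀ (s : ℝ) (x y : E), 0 ≤ pD s x y)
    {ν : Measure ℝ} (hν : IsLevyMeasure ν) (c β K C1 C2 : ℝ) (hc : 0 < c) (hβ : 0 < β) (hK : 1 ≤ K)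
    (hC1 : 0 < C1) (hC2 : 0 < C2)
    (C₀ : ℝ) (hC₀ : C₀ = 0 ∨ C₀ = 1)
    (hw : ∀ x y : E, x ∈ D → y ∈ D → x ≠ y → ∀ u, 0 < u → u ≤ Φ (dist x y) →
      levyTail ν u ≤ c * (Φ (dist x y) / u) ^ β * levyTail ν (Φ (dist x y)))
    (hg : ∀ x y : E, x ∈ D → y ∈ D → x ≠ y → ∀ u, 0 < u → u ≤ Φ (dist x y) →
      levyTail ν (K * u) ≤ levyTail ν u / 2)
    (hh : ∀ x y : E, x ∈ D → y ∈ D → x ≠ y → ∀ s t, 0 < s → s ≤ t → t ≤ Φ (dist x y) →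
      h s x y ≤ cH * (t / s) ^ γ * h t x y)
    (hpt : ∀ x y : E, x ∈ D → y ∈ D → x ≠ y → ∀ s : ℝ, 0 < s →
      (s ≤ Φ (dist x y) → pD s x y ≤ C1 * (C₀ / (vol m x (dist x y) * Ψ (dist x y)) * (h s x y * s) +
        (vol m x (dist x y))⁻¹ * h (Φ (dist x y)) x y * (s / Φ (dist x y)) ^ (β + 1))) ∧
      (Φ (dist x y) < s → pD s x y ≤ C1 * ((vol m x (dist x y))⁻¹ * h (Φ (dist x y)) x y)) ∧
      (s ≤ Φ (dist x y) → C2 * (C₀ / (vol m x (dist x y) * Ψ (dist x y))) * (h s x y * s) ≤ pD s x y) ∧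
      (Φ (dist x y) < s → s ≤ K * Φ (dist x y) →
        C2 * (vol m x (dist x y))⁻¹ * h (Φ (dist x y)) x y ≤ pD s x y)) :
    ∃ C : ℝ, 1 ≤ C ∧ ∀ x y : E, x ∈ D → y ∈ D → x ≠ y →
      C⁻¹ * (C₀ * (∫ s in Set.Ioc (0:ℝ) (Φ (dist x y)), h s x y * levyTail ν s) /
            (vol m x (dist x y) * Ψ (dist x y)) +
          h (Φ (dist x y)) x y * levyTail ν (Φ (dist x y)) / vol m x (dist x y))
        ≤ subJ ν pD x y ∧
      subJ ν pD x y ≤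
        C * (C₀ * (∫ s in Set.Ioc (0:ℝ) (Φ (dist x y)), h s x y * levyTail ν s) /
            (vol m x (dist x y) * Ψ (dist x y)) +
          h (Φ (dist x y)) x y * levyTail ν (Φ (dist x y)) / vol m x (dist x y)) := by
  obtain ⟨C, hC, H⟩ := jk_core hν c β K cH γ C1 C2 hβ hK hcH hγ hc hC1 hC2
  refine ⟨C, hC, fun x y hx hy hxy => ?_⟩
  have hr : 0 < dist x y := dist_pos.2 hxy
  have hT : 0 < Φ (dist x y) := by
    rw [← hΦ0]; exact hΦmono Set.self_mem_Ici hr.le hr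
  have hV := jk_vol_pos hm x hr
  have hTH := hΦΨ _ hr.le
  have hH : 0 < Ψ (dist x y) := hT.trans_le hTH
  have hC₀0 : 0 ≤ C₀ := by rcases hC₀ with h | h <;> rw [h]; exact zero_le_one
  have hC₀1 : C₀ ≤ 1 := by rcases hC₀ with h | h <;> rw [h]; exact zero_le_one
  have hp := hpt x y hx hy hxy
  set g : ℝ → ℝ := fun s => if 0 < s then h s x y else 1 with hgdef
  have gpos : ∀ s, 0 < s → g s = h s x y := fun s hs => by simp [hgdef, hs]
  have g0 : ∀ s, 0 ≤ g s := fun s => by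
    by_cases hs : 0 < s
    · rw [gpos s hs]; exact (hh01 s x y hs hx hy).1
    · simp [hgdef, hs]
  have g1 : ∀ s, g s ≤ 1 := fun s => by
    by_cases hs : 0 < s
    · rw [gpos s hs]; exact (hh01 s x y hs hx hy).2
    · simp [hgdef, hs]
  have ga : Antitone g := fun s t hst => by
    by_cases hs : 0 < s
    · rw [gpos s hs, gpos t (hs.trans_le hst)]; exact hhm x y hx hy s t hs hst
    · have : g s = 1 := by simp [hgdef, hs]
      rw [this]; exact g1 t
  have key := H (Φ (dist x y)) (C₀ / (vol m x (dist x y) * Ψ (dist x y))) (vol m x (dist x y))⁻¹ g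
    (fun s => pD s x y) hT (by positivity) (by positivity) ?_ (hw x y hx hy hxy) (hg x y hx hy hxy)
    ga g0 g1 ?_ (hpD_meas x y) (fun s => hpD_nonneg s x y) ?_ ?_ ?_ ?_
  · have e1 : ∫ s in Set.Ioc (0:ℝ) (Φ (dist x y)), g s * levyTail ν s =
        ∫ s in Set.Ioc (0:ℝ) (Φ (dist x y)), h s x y * levyTail ν s :=
      setIntegral_congr_fun measurableSet_Ioc fun s hs => by simp only [gpos s hs.1]
    rw [e1, gpos _ hT] at key
    have e2 : ∀ I W : ℝ, C₀ / (vol m x (dist x y) * Ψ (dist x y)) * I +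
        (vol m x (dist x y))⁻¹ * h (Φ (dist x y)) x y * W =
        C₀ * I / (vol m x (dist x y) * Ψ (dist x y)) +
          h (Φ (dist x y)) x y * W / vol m x (dist x y) := fun I W => by ring
    rw [e2] at key
    exact key
  · calc C₀ / (vol m x (dist x y) * Ψ (dist x y)) * Φ (dist x y)
        ≤ 1 / (vol m x (dist x y) * Ψ (dist x y)) * Ψ (dist x y) := by gcongr
      _ = (vol m x (dist x y))⁻¹ := by field_simp
  · intro s t hs hst ht
    rw [gpos s hs, gpos t (hs.trans_le hst)]; exact hh x y hx hy hxy s t hs hst ht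
  · intro s hs hsT
    rw [gpos s hs, gpos _ hT]; exact (hp s hs).1 hsT
  · intro s hs
    rw [gpos _ hT]; exact (hp s (hT.trans hs)).2.1 hs
  · intro s hs hsT
    rw [gpos s hs]; exact (hp s hs).2.2.1 hsT
  · intro s hs hsT
    rw [gpos _ hT]; exact (hp s (hT.trans hs)).2.2.2 hs hsT

/-- Theorem 4.1: two-sided estimates of the jump kernel of the subordinate process. -/
theorem jump_kernel_estimate
    {E : Type*} [MetricSpace E] [MeasurableSpace E] [BorelSpace E] [ProperSpace E]
    [TopologicalSpace.SeparableSpace E]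
    (m : Measure E) (R_E : ℝ≥0∞) (d₁ d₂ : ℝ)
    (hm : ∀ (x : E) (r : ℝ), 0 < r → 0 < m (Metric.ball x r) ∧ m (Metric.ball x r) < ⊤)
    (hRE : 0 < R_E) (hd₁ : 0 < d₁) (hd : d₁ ≤ d₂) (hVD : VolDoubling m R_E d₁ d₂)
    (D : Set E) (hDopen : IsOpen D) (hDne : D.Nonempty) (hDproper : D ≠ Set.univ)
    (Φ Ψ : ℝ → ℝ) (cA cA' α₁ α₂ cB cB' α₃ α₄ : ℝ)
    (hΦ0 : Φ 0 = 0) (hΦmono : StrictMonoOn Φ (Set.Ici 0))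
    (hΨ0 : Ψ 0 = 0) (hΨmono : StrictMonoOn Ψ (Set.Ici 0))
    (hΦΨ : ∀ r : ℝ, 0 ≤ r → Φ r ≤ Ψ r)
    (hcA : 0 < cA) (hcA' : 0 < cA') (hα₁ : 0 < α₁) (hα₁₂ : α₁ ≤ α₂)
    (hcB : 0 < cB) (hcB' : 0 < cB') (hα₃ : 0 < α₃) (hα₃₄ : α₃ ≤ α₄)
    (hΦsc : WeakScaling Φ cA cA' α₁ α₂) (hΨsc : WeakScaling Ψ cB cB' α₃ α₄)
    (ΦInv : ℝ → ℝ) (hΦInv : ∀ s : ℝ, 0 < s → 0 < ΦInv s ∧ Φ (ΦInv s) = s)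
    (h : ℝ → E → E → ℝ) (cH γ : ℝ) (hcH : 0 < cH) (hγ : 0 ≤ γ)
    (pD : ℝ → E → E → ℝ)
    (hpD_meas : ∀ x y : E, Measurable fun s => pD s x y)
    (hpD_nonneg : ∀ (s : ℝ) (x y : E), 0 ≤ pD s x y)
    (ν : Measure ℝ) (μ : ℝ → Measure ℝ) (hsub : IsSubordinatorLaw ν μ)
    (φInv : ℝ → ℝ) (hφInv : IsPhiInv ν φInv)
    (R₁ : ℝ≥0∞) (cw cw' β₁ β₂ : ℝ) (hR₁ : 0 < R₁)
    (hcw : 0 < cw) (hcw' : 0 < cw') (hβ₁ : 0 < β₁) (hβ : β₁ ≤ β₂)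
    (C₀ cl cexl cu cexu : ℝ) (hC₀ : C₀ = 0 ∨ C₀ = 1)
    (hcl : 0 < cl) (hcexl : 0 < cexl) (hcu : 0 < cu) (hcexu : 0 < cexu)
    (hcase :
      BddCaseHyp m D Φ Ψ ΦInv h pD ν R₁ cw cw' β₁ β₂ cH γ C₀ cl cexl cu cexu ∨
      UnbddCaseHyp m D Ψ ΦInv h pD ν R_E cw cw' β₁ β₂ cH γ C₀ cl cexl cu cexu) :
    ∃ C : ℝ, 1 ≤ C ∧ ∀ x y : E, x ∈ D → y ∈ D → x ≠ y →
      C⁻¹ * (C₀ * (∫ s in Set.Ioc (0:ℝ) (Φ (dist x y)), h s x y * levyTail ν s) /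
            (vol m x (dist x y) * Ψ (dist x y)) +
          h (Φ (dist x y)) x y * levyTail ν (Φ (dist x y)) / vol m x (dist x y))
        ≤ subJ ν pD x y ∧
      subJ ν pD x y ≤
        C * (C₀ * (∫ s in Set.Ioc (0:ℝ) (Φ (dist x y)), h s x y * levyTail ν s) /
            (vol m x (dist x y) * Ψ (dist x y)) +
          h (Φ (dist x y)) x y * levyTail ν (Φ (dist x y)) / vol m x (dist x y)) := by

  have hν := hsub.levy
  have hβ₂ : 0 < β₂ := hβ₁.trans_le hβ
  have hd₂ : 0 < d₂ := hd₁.trans_le hd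
  have hTpos : ∀ x y : E, x ≠ y → 0 < Φ (dist x y) := fun x y hxy => by
    have hr : 0 < dist x y := dist_pos.2 hxy
    rw [← hΦ0]; exact hΦmono Set.self_mem_Ici hr.le hr
  rcases hcase with hB | hU
  · obtain ⟨hP, hDb, h8, ⟨hh01, hhm, hH2⟩, hHK, lamD, c₅, c₆, hlam, hc₅, hc₆, hL⟩ := hB
    by_cases hsub' : D.Subsingleton
    · exact ⟨1, le_rfl, fun x y hx hy hxy => absurd (hsub' hx hy) hxy⟩
    have hdiam : 0 < Metric.diam D := by
      obtain ⟨a, ha, b, hb, hab⟩ := Set.not_subsingleton_iff.1 hsub'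
      exact (dist_pos.2 hab).trans_le (Metric.dist_le_diam_of_mem hDb ha hb)
    set T0 := Φ (Metric.diam D) with hT0def
    have hT0 : 0 < T0 := by
      rw [← hΦ0]; exact hΦmono Set.self_mem_Ici hdiam.le hdiam
    have hT0R : ENNReal.ofReal T0 < R₁ :=
      (ENNReal.ofReal_le_ofReal (by linarith)).trans_lt h8
    have hTle : ∀ x y : E, x ∈ D → y ∈ D → Φ (dist x y) ≤ T0 := fun x y hx hy =>
      hΦmono.monotoneOn dist_nonneg hdiam.le (Metric.dist_le_diam_of_mem hDb hx hy)
    obtain ⟨K, hK, hKw⟩ := jk_K hν hP hcw hβ₁ hR₁ hT0 hT0R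
    have hK0 : 0 < K := by linarith
    -- volume doubling up to a fixed radius
    set Rm : ℝ := Metric.diam D + 1 + ΦInv 1 with hRm
    have hi1 := (hΦInv 1 one_pos).1
    have hRm0 : 0 < Rm := by positivity
    have hVD' : ∃ CV : ℝ, 1 ≤ CV ∧ ∀ (x : E) (r R : ℝ), 0 < r → r ≤ R → R ≤ Rm →
        vol m x R ≤ CV * (R / r) ^ d₂ * vol m x r := by
      have hex : ∃ a : ℝ, 1 ≤ a ∧ ENNReal.ofReal Rm < ENNReal.ofReal a * R_E := by
        by_cases hT : R_E = ⊤
        · refine ⟨1, le_rfl, ?_⟩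
          rw [hT, ENNReal.ofReal_one, one_mul]; exact ENNReal.ofReal_lt_top
        · have hq : 0 < R_E.toReal := ENNReal.toReal_pos hRE.ne' hT
          refine ⟨1 + Rm / R_E.toReal, by have : 0 ≤ Rm / R_E.toReal := by positivity
                                          linarith, ?_⟩
          rw [← ENNReal.ofReal_toReal hT, ENNReal.toReal_ofReal hq.le,
            ← ENNReal.ofReal_mul (by positivity)]
          refine (ENNReal.ofReal_lt_ofReal_iff (by positivity)).2 ?_
          have : (1 + Rm / R_E.toReal) * R_E.toReal = R_E.toReal + Rm := by field_simp
          rw [this]; linarith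
      obtain ⟨a, ha, haR⟩ := hex
      obtain ⟨CV, hCV, hV⟩ := hVD a ha
      refine ⟨CV, hCV, fun x r R hr hrR hRR => ?_⟩
      have := (hV x r R hr hrR ((ENNReal.ofReal_le_ofReal hRR).trans_lt haR)).2
      rwa [div_le_iff₀ (jk_vol_pos hm x hr)] at this
    obtain ⟨CV, hCV, hVDm⟩ := hVD'
    have hCV0 : 0 < CV := by linarith
    obtain ⟨x0, hx0⟩ := hDne
    have hdist : ∀ x y : E, x ∈ D → y ∈ D → dist x y ≤ Metric.diam D := fun x y hx hy =>
      Metric.dist_le_diam_of_mem hDb hx hy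
    -- volume bounds
    set Vhi : ℝ := vol m x0 (2 * Rm) with hVhi
    have hVhi0 : 0 < Vhi := jk_vol_pos hm x0 (by positivity)
    have hVhi' : ∀ x y : E, x ∈ D → y ∈ D → vol m x (dist x y) ≤ Vhi := fun x y hx hy => by
      refine jk_vol_mono hm (by positivity) (Metric.ball_subset_ball' ?_)
      have := hdist x y hx hy
      have := hdist x x0 hx hx0
      linarith
    obtain ⟨hr0, hr0s⟩ := hΦInv (1 / K) (by positivity)
    set r0 := ΦInv (1 / K) with hr0def
    set Vlo : ℝ := vol m x0 1 / (CV * (Rm / r0) ^ d₂) with hVlo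
    have hVlo0 : 0 < Vlo := div_pos (jk_vol_pos hm x0 one_pos) (by positivity)
    have hVlo' : ∀ x y : E, x ∈ D → y ∈ D → x ≠ y → 1 ≤ K * Φ (dist x y) →
        Vlo ≤ vol m x (dist x y) := fun x y hx hy hxy hKT => by
      have hr : 0 < dist x y := dist_pos.2 hxy
      have hle : r0 ≤ dist x y := by
        have h1 : Φ r0 ≤ Φ (dist x y) := by
          rw [hr0s, div_le_iff₀ hK0]; linarith
        exact (hΦmono.le_iff_le hr0.le hr.le).1 h1
      have hdR : dist x y ≤ Rm := by have := hdist x y hx hy; linarith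
      refine le_trans ?_ (jk_vol_mono hm hr (Metric.ball_subset_ball hle))
      rw [hVlo, div_le_iff₀ (by positivity), mul_comm]
      refine le_trans ?_ (hVDm x r0 Rm hr0 (hle.trans hdR) le_rfl)
      refine jk_vol_mono hm hRm0 (Metric.ball_subset_ball' ?_)
      have := hdist x0 x hx0 hx
      linarith
    have hH2' : ∀ x y : E, x ∈ D → y ∈ D → ∀ s t : ℝ, 0 < s → s ≤ t → t < 4 * T0 + 1 →
        h s x y ≤ cH * (t / s) ^ γ * h t x y := fun x y hx hy s t hs hst ht =>
      jk_H2 hs (hs.trans_le hst) (hH2 x y hx hy s t hs hst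
        ((ENNReal.ofReal_lt_ofReal_iff (by positivity)).2 ht))
    obtain ⟨C1, C2, hC1, hC2, hpt⟩ := jk_pt m d₂ hm hd₂ CV hCV (fun R => R ≤ Rm) hVDm D Φ Ψ cA cA' α₁ α₂
      hΦ0 hΦmono hΦΨ hcA hcA' hα₁ hΦsc ΦInv hΦInv h cH γ hcH hγ hh01 hhm pD β₂ K hβ₂ hK C₀ cl cexl cu
      cexu hC₀ hcl hcexl hcu hcexu _ hHK
    obtain ⟨C1', C2', hC1', hC2', hpt'⟩ := jk_large T0 Vlo Vhi cH γ c₅ c₆ lamD β₂ K hT0 hVlo0 hVhi0 hcH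
      hγ hc₅ hc₆ hlam hβ₂ hK
    refine jk_final m hm D Φ Ψ hΦ0 hΦmono hΦΨ h cH γ hcH hγ hh01 hhm pD hpD_meas hpD_nonneg hν cw' β₂ K
      (max C1 C1') (min C2 C2') hcw' hβ₂ hK (lt_max_of_lt_left hC1) (lt_min hC2 hC2') C₀ hC₀
      (fun x y hx hy hxy u hu huT => jk_tail_scale hP hcw hu huT
        ((ENNReal.ofReal_le_ofReal (hTle x y hx hy)).trans_lt hT0R))
      (fun x y hx hy hxy u hu huT => hKw u hu (huT.trans (hTle x y hx hy)))
      (fun x y hx hy hxy s t hs hst ht => hH2' x y hx hy s t hs hst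
        (by have := hTle x y hx hy; linarith)) ?_
    intro x y hx hy hxy s hs
    have hr : 0 < dist x y := dist_pos.2 hxy
    have hT := hTpos x y hxy
    have hTT := hTle x y hx hy
    have hV := jk_vol_pos hm x hr
    have hΨT := hΦΨ _ hr.le
    have hΨ := hT.trans_le hΨT
    have hhs := (hh01 s x y hs hx hy).1
    have hhT := (hh01 _ x y hT hx hy).1
    have hC₀0 : 0 ≤ C₀ := by rcases hC₀ with h | h <;> rw [h]; exact zero_le_one
    have hall : ∃ E1 E2 : ℝ, E1 ≤ max C1 C1' ∧ min C2 C2' ≤ E2 ∧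
      ((s ≤ Φ (dist x y) → pD s x y ≤ E1 * (C₀ / (vol m x (dist x y) * Ψ (dist x y)) * (h s x y * s) +
        (vol m x (dist x y))⁻¹ * h (Φ (dist x y)) x y * (s / Φ (dist x y)) ^ (β₂ + 1))) ∧
      (Φ (dist x y) < s → pD s x y ≤ E1 * ((vol m x (dist x y))⁻¹ * h (Φ (dist x y)) x y)) ∧
      (s ≤ Φ (dist x y) → E2 * (C₀ / (vol m x (dist x y) * Ψ (dist x y))) * (h s x y * s) ≤ pD s x y) ∧
      (Φ (dist x y) < s → s ≤ K * Φ (dist x y) →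
        E2 * (vol m x (dist x y))⁻¹ * h (Φ (dist x y)) x y ≤ pD s x y)) := by
      rcases le_or_gt s 1 with hs1 | hs1
      · refine ⟨C1, C2, le_max_left _ _, min_le_left _ _, hpt x y hx hy hxy s hs hs1 ?_ ?_ ?_ ?_⟩
        · have := hdist x y hx hy
          show dist x y ≤ Rm
          linarith
        · show ΦInv s ≤ Rm
          have h1 : ΦInv s ≤ ΦInv 1 := by
            refine (hΦmono.le_iff_le (hΦInv s hs).1.le hi1.le).1 ?_
            rw [(hΦInv s hs).2, (hΦInv 1 one_pos).2]; exact hs1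
          linarith
        · intro h1; exact hH2' x y hx hy _ _ hs h1 (by linarith)
        · intro h1; exact hH2' x y hx hy _ _ hT h1.le (by linarith)
      · refine ⟨C1', C2', le_max_right _ _, min_le_right _ _,
          hpt' s (Φ (dist x y)) _ (Ψ (dist x y)) (h s x y) (h (Φ (dist x y)) x y) (h 1 x y) _ C₀ hs1 hT
            hTT hV (hVhi' x y hx hy) (hVlo' x y hx hy hxy) hΨT hhs hhT (hh01 1 x y one_pos hx hy).1 hC₀
            (hhm x y hx hy 1 s one_pos hs1.le) (hL s x y hs1.le hx hy).1 (hL s x y hs1.le hx hy).2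
            ?_ ?_⟩
        · intro h1
          exact ⟨hhm x y hx hy _ _ hT h1, hH2' x y hx hy _ _ hT h1 (by linarith)⟩
        · intro h1
          exact ⟨hhm x y hx hy _ _ one_pos h1, hH2' x y hx hy _ _ one_pos h1 (by linarith)⟩
    obtain ⟨E1, E2, hE1, hE2, q1, q2, q3, q4⟩ := hall
    refine ⟨fun a => (q1 a).trans ?_, fun a => (q2 a).trans ?_, fun a => le_trans ?_ (q3 a),
      fun a b => le_trans ?_ (q4 a b)⟩
    · gcongr
    · gcongr
    · gcongr
    · gcongr
  · obtain ⟨hP, hRT, ⟨hh01, hhm, hH2⟩, hHK⟩ := hU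
    obtain ⟨K, hK, hKw⟩ := jk_K0 hP hcw hβ₁
    obtain ⟨CV, hCV, hV⟩ := hVD 1 le_rfl
    have hVDm : ∀ (x : E) (r R : ℝ), 0 < r → r ≤ R → True →
        vol m x R ≤ CV * (R / r) ^ d₂ * vol m x r := fun x r R hr hrR _ => by
      have := (hV x r R hr hrR (by
        rw [hRT, ENNReal.ofReal_one, one_mul]; exact ENNReal.ofReal_lt_top)).2
      rwa [div_le_iff₀ (jk_vol_pos hm x hr)] at this
    have hH2' : ∀ x y : E, x ∈ D → y ∈ D → ∀ s t : ℝ, 0 < s → s ≤ t →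
        h s x y ≤ cH * (t / s) ^ γ * h t x y := fun x y hx hy s t hs hst =>
      jk_H2 hs (hs.trans_le hst) (hH2 x y hx hy s t hs hst ENNReal.ofReal_lt_top)
    obtain ⟨C1, C2, hC1, hC2, hpt⟩ := jk_pt m d₂ hm hd₂ CV hCV (fun _ => True) hVDm D Φ Ψ cA cA' α₁ α₂
      hΦ0 hΦmono hΦΨ hcA hcA' hα₁ hΦsc ΦInv hΦInv h cH γ hcH hγ hh01 hhm pD β₂ K hβ₂ hK C₀ cl cexl cu
      cexu hC₀ hcl hcexl hcu hcexu _ hHK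
    exact jk_final m hm D Φ Ψ hΦ0 hΦmono hΦΨ h cH γ hcH hγ hh01 hhm pD hpD_meas hpD_nonneg hν cw' β₂ K
      C1 C2 hcw' hβ₂ hK hC1 hC2 C₀ hC₀
      (fun x y hx hy hxy u hu huT => jk_tail_scale hP hcw hu huT ENNReal.ofReal_lt_top)
      (fun x y hx hy hxy u hu huT => hKw u hu ENNReal.ofReal_lt_top)
      (fun x y hx hy hxy s t hs hst ht => hH2' x y hx hy s t hs hst)
      (fun x y hx hy hxy s hs => hpt x y hx hy hxy s hs trivial trivial trivial
        (fun h1 => hH2' x y hx hy _ _ hs h1)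
        (fun h1 => hH2' x y hx hy _ _ (hTpos x y hxy) h1.le))
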